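/- arXiv:1312.1234 — 2 statements merged into one kernel-verified Lean document; each statement's English description precedes it below -/
import Mathlib

section
/- For every integer k ≥ 2, the tree T_k has edge-reconstruction number equal to 3. -/
open SimpleGraph

namespace ErnPaper

/-- The weight of a vertex `v` in a graph `G`: the number of vertices in a largest
connected component of `G - v`. -/
noncomputable def wt {V : Type} [Fintype V] (G : SimpleGraph V) (v : V) : ℕ :=
  sSup {n | ∃ c : (G.induce ({v}ᶜ : Set V)).ConnectedComponent, n = Nat.card c.supp}

/-- The centroid of a graph: the set of vertices of minimum weight. -/
def centroid {V : Type} [Fintype V] (G : SimpleGraph V) : Set V :=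
  {v | ∀ u, wt G v ≤ wt G u}

/-- The edge-reconstruction number of a finite graph `G`: the least `k` for which there exist
`k` distinct edges `e₁, …, e_k` of `G` such that any finite graph `H` having `k` distinct
edges `f₁, …, f_k` with `H - fᵢ ≅ G - eᵢ` for all `i` must be isomorphic to `G`. -/
noncomputable def ern {V : Type} [Fintype V] (G : SimpleGraph V) : ℕ :=
  sInf {k | ∃ s : Finset (Sym2 V), s.card = k ∧ (↑s : Set (Sym2 V)) ⊆ G.edgeSet ∧
    ∀ (W : Type) (_ : Fintype W) (H : SimpleGraph W) (t : Finset (Sym2 W)),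
      (↑t : Set (Sym2 W)) ⊆ H.edgeSet →
      (∃ φ : {e // e ∈ s} ≃ {f // f ∈ t},
        ∀ e : {e // e ∈ s},
          Nonempty (H.deleteEdges {(φ e).1} ≃g G.deleteEdges {e.1})) →
      Nonempty (H ≃g G)}

/-- The spider tree `S_{p,q,r}`: three paths with `p`, `q`, `r` edges respectively,
emanating from a common central vertex. -/
def spider (p q r : ℕ) : SimpleGraph (Unit ⊕ (Fin p ⊕ Fin q ⊕ Fin r)) :=
  SimpleGraph.fromRel fun x y =>
    match x, y with
    | Sum.inl _, Sum.inr (Sum.inl j) => (j : ℕ) = 0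
    | Sum.inl _, Sum.inr (Sum.inr (Sum.inl j)) => (j : ℕ) = 0
    | Sum.inl _, Sum.inr (Sum.inr (Sum.inr j)) => (j : ℕ) = 0
    | Sum.inr (Sum.inl i), Sum.inr (Sum.inl j) => (j : ℕ) = (i : ℕ) + 1
    | Sum.inr (Sum.inr (Sum.inl i)), Sum.inr (Sum.inr (Sum.inl j)) => (j : ℕ) = (i : ℕ) + 1
    | Sum.inr (Sum.inr (Sum.inr i)), Sum.inr (Sum.inr (Sum.inr j)) => (j : ℕ) = (i : ℕ) + 1
    | _, _ => False

/-- A pseudopath: a tree isomorphic to a path `P_k`, to `S_{1,1,2}`, or to `S_{1,2,3}`. -/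
def IsPseudopath {V : Type} (T : SimpleGraph V) : Prop :=
  (∃ k, Nonempty (T ≃g pathGraph k)) ∨
    Nonempty (T ≃g spider 1 1 2) ∨ Nonempty (T ≃g spider 1 2 3)

/-- `T - xv + yv`: delete the end-edge `xv` and add the new edge `yv`. -/
def replaceEdge {V : Type} (T : SimpleGraph V) (x v y : V) : SimpleGraph V :=
  SimpleGraph.fromEdgeSet ((T.edgeSet \ {s(x, v)}) ∪ {s(y, v)})

/-- The disjoint union of two simple graphs. -/
def disjUnion {α β : Type} (G : SimpleGraph α) (H : SimpleGraph β) :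
    SimpleGraph (α ⊕ β) :=
  SimpleGraph.fromRel fun x y =>
    match x, y with
    | Sum.inl a, Sum.inl b => G.Adj a b
    | Sum.inr a, Sum.inr b => H.Adj a b
    | _, _ => False

/-- The caterpillar `C(2,0,…,0,2)` with spine on `m` vertices: spine path `v₀ … v_{m-1}`,
with two extra endvertices adjacent to `v₀` and two to `v_{m-1}`. -/
def doubleBroom (m : ℕ) : SimpleGraph (Fin m ⊕ Fin 4) :=
  SimpleGraph.fromRel fun x y =>
    match x, y with
    | Sum.inl i, Sum.inl j => (j : ℕ) = (i : ℕ) + 1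
    | Sum.inl i, Sum.inr l =>
        ((i : ℕ) = 0 ∧ (l : ℕ) < 2) ∨ ((i : ℕ) = m - 1 ∧ 2 ≤ (l : ℕ))
    | _, _ => False


/-- The tree `T_k` on `3k + 1` vertices: a central vertex adjacent to `k` vertices,
each of which is additionally adjacent to two endvertices. -/
def Tfam (k : ℕ) : SimpleGraph (Unit ⊕ Fin k × Fin 3) :=
  SimpleGraph.fromRel fun x y =>
    match x, y with
    | Sum.inl _, Sum.inr (_, j) => (j : ℕ) = 0
    | Sum.inr (i, j), Sum.inr (i', j') => i = i' ∧ (j : ℕ) = 0 ∧ (j' : ℕ) ≠ 0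
    | _, _ => False

/-- Transport of an edge-deleted card along an equivalence of vertex sets. -/
theorem delIso {V W : Type} (G : SimpleGraph V) (H : SimpleGraph W) (σ : V ≃ W) (a b : V) (c d : W)
    (h : ∀ u v, (H.Adj (σ u) (σ v) ∧ s(σ u, σ v) ≠ s(c, d)) ↔ (G.Adj u v ∧ s(u, v) ≠ s(a, b))) :
    Nonempty (G.deleteEdges {s(a, b)} ≃g H.deleteEdges {s(c, d)}) := by
  refine ⟨⟨σ, ?_⟩⟩
  intro u v
  simpa [SimpleGraph.deleteEdges_adj] using h u v

abbrev cc (n : ℕ) : Unit ⊕ Fin (n+2) × Fin 3 := Sum.inl ()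
abbrev vv {n : ℕ} (i : Fin (n+2)) (j : Fin 3) : Unit ⊕ Fin (n+2) × Fin 3 := Sum.inr (i, j)

theorem adj_cc (n : ℕ) (x y : Unit) : ¬ (Tfam (n+2)).Adj (Sum.inl x) (Sum.inl y) := by
  simp [Tfam]
theorem adj_cv (n : ℕ) (x : Unit) (i : Fin (n+2)) (j : Fin 3) :
    (Tfam (n+2)).Adj (Sum.inl x) (Sum.inr (i, j)) ↔ j = 0 := by
  simp [Tfam]
theorem adj_vc (n : ℕ) (x : Unit) (i : Fin (n+2)) (j : Fin 3) :
    (Tfam (n+2)).Adj (Sum.inr (i, j)) (Sum.inl x) ↔ j = 0 := by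
  simp [Tfam]
theorem adj_vv (n : ℕ) (i i' : Fin (n+2)) (j j' : Fin 3) :
    (Tfam (n+2)).Adj (Sum.inr (i, j)) (Sum.inr (i', j')) ↔
      i = i' ∧ ((j = 0 ∧ j' ≠ 0) ∨ (j' = 0 ∧ j ≠ 0)) := by
  simp only [Tfam, SimpleGraph.fromRel_adj, Fin.val_eq_zero_iff, ne_eq, Sum.inr.injEq, Prod.mk.injEq]
  grind

theorem fin3 (j : Fin 3) : j = 0 ∨ j = 1 ∨ j = 2 := by
  fin_cases j <;> simp

/-- Every edge is equivalent to a standard edge. -/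
theorem edge_std (n : ℕ) (e : Sym2 (Unit ⊕ Fin (n+2) × Fin 3)) (he : e ∈ (Tfam (n+2)).edgeSet) :
    Nonempty ((Tfam (n+2)).deleteEdges {s(vv 0 0, vv 0 1)} ≃g (Tfam (n+2)).deleteEdges {e}) ∨
    Nonempty ((Tfam (n+2)).deleteEdges {s(cc n, vv 0 0)} ≃g (Tfam (n+2)).deleteEdges {e}) := by
  have main : ∀ (i : Fin (n+2)) (τ : Equiv.Perm (Fin 3)), τ 0 = 0 →
      ∃ σ : (Unit ⊕ Fin (n+2) × Fin 3) ≃ (Unit ⊕ Fin (n+2) × Fin 3),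
        σ (cc n) = cc n ∧ (∀ j, σ (vv 0 j) = vv i (τ j)) ∧
        ∀ u v, (Tfam (n+2)).Adj (σ u) (σ v) ↔ (Tfam (n+2)).Adj u v := by
    intro i τ h
    refine ⟨Equiv.sumCongr (Equiv.refl _) (Equiv.prodCongr (Equiv.swap 0 i) τ), by simp, by simp, ?_⟩
    have h0 : ∀ j, τ j = 0 ↔ j = 0 := fun j => by
      constructor
      · intro hj; exact τ.injective (hj.trans h.symm)
      · rintro rfl; exact h
    rintro (x | ⟨i1, j1⟩) (y | ⟨i2, j2⟩) <;>
      simp [adj_cc, adj_cv, adj_vc, adj_vv, h0]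
  have fin : ∀ (i : Fin (n+2)) (τ : Equiv.Perm (Fin 3)), τ 0 = 0 →
      Nonempty ((Tfam (n+2)).deleteEdges {s(vv 0 0, vv 0 1)} ≃g
        (Tfam (n+2)).deleteEdges {s(vv i 0, vv i (τ 1))}) ∧
      Nonempty ((Tfam (n+2)).deleteEdges {s(cc n, vv 0 0)} ≃g
        (Tfam (n+2)).deleteEdges {s(cc n, vv i 0)}) := by
    intro i τ h
    obtain ⟨σ, h1, h2, h3⟩ := main i τ h
    constructor
    · apply delIso _ _ σ
      intro u v
      rw [h3]
      have : s(vv i 0, vv i (τ 1)) = Sym2.map σ s(vv 0 0, vv 0 1) := by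
        simp [h2, h]
      rw [this, ← Sym2.map_mk, (Sym2.map.injective σ.injective).ne_iff]
    · apply delIso _ _ σ
      intro u v
      rw [h3]
      have : s(cc n, vv i 0) = Sym2.map σ s(cc n, vv 0 0) := by
        simp [h2, h, h1]
      rw [this, ← Sym2.map_mk, (Sym2.map.injective σ.injective).ne_iff]
  have leaf : ∀ (i : Fin (n+2)) (j : Fin 3), j ≠ 0 →
      Nonempty ((Tfam (n+2)).deleteEdges {s(vv 0 0, vv 0 1)} ≃g
        (Tfam (n+2)).deleteEdges {s(vv i 0, vv i j)}) := by
    intro i j hj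
    have := (fin i (Equiv.swap 1 j) (Equiv.swap_apply_of_ne_of_ne (by decide) hj.symm)).1
    simpa using this
  have cen : ∀ (i : Fin (n+2)), 
      Nonempty ((Tfam (n+2)).deleteEdges {s(cc n, vv 0 0)} ≃g
        (Tfam (n+2)).deleteEdges {s(cc n, vv i 0)}) :=
    fun i => (fin i (Equiv.refl _) rfl).2
  induction e using Sym2.ind with
  | _ x y =>
    rw [SimpleGraph.mem_edgeSet] at he
    rcases x with (⟨⟩ | ⟨i1, j1⟩) <;> rcases y with (⟨⟩ | ⟨i2, j2⟩)
    · exact absurd he (adj_cc _ _ _)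
    · rw [adj_cv] at he; subst he
      exact Or.inr (cen i2)
    · rw [adj_vc] at he; subst he
      rw [Sym2.eq_swap (a := Sum.inr (i1, 0))]
      exact Or.inr (cen i1)
    · rw [adj_vv] at he
      obtain ⟨rfl, ⟨rfl, h⟩ | ⟨rfl, h⟩⟩ := he
      · exact Or.inl (leaf _ _ h)
      · rw [Sym2.eq_swap (a := Sum.inr (i1, j1))]
        exact Or.inl (leaf _ _ h)

/-- `G` with the edge `ab` deleted and the edge `cd` added. -/
def mv {V : Type} (G : SimpleGraph V) (a b c d : V) : SimpleGraph V :=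
  SimpleGraph.fromEdgeSet ((G.edgeSet \ {s(a, b)}) ∪ {s(c, d)})

theorem mv_adj {V : Type} (G : SimpleGraph V) (a b c d : V) (h : c ≠ d) (u v : V) :
    (mv G a b c d).Adj u v ↔ (G.Adj u v ∧ s(u, v) ≠ s(a, b)) ∨ s(u, v) = s(c, d) := by
  simp only [mv, SimpleGraph.fromEdgeSet_adj, Set.mem_union, Set.mem_sdiff, SimpleGraph.mem_edgeSet,
    Set.mem_singleton_iff]
  constructor
  · exact fun h => h.1
  · intro h'
    refine ⟨h', ?_⟩
    rcases h' with h' | h'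
    · exact h'.1.ne
    · rintro rfl
      have : (s(u, u) : Sym2 V).IsDiag := rfl
      rw [h'] at this
      exact h this

theorem mv_del {V : Type} (G : SimpleGraph V) (a b c d : V) (h : c ≠ d) (hn : ¬ G.Adj c d) :
    Nonempty ((mv G a b c d).deleteEdges {s(c, d)} ≃g G.deleteEdges {s(a, b)}) := by
  apply delIso _ _ (Equiv.refl V)
  intro u v
  rw [mv_adj _ _ _ _ _ h]
  have : G.Adj u v → s(u, v) ≠ s(c, d) := by
    intro h1 h2
    rw [← SimpleGraph.mem_edgeSet, h2] at h1
    exact hn h1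
  simp only [Equiv.refl_apply]
  tauto

theorem tri_free (n : ℕ) (x y z) (h1 : (Tfam (n+2)).Adj x y) (h2 : (Tfam (n+2)).Adj y z)
    (h3 : (Tfam (n+2)).Adj x z) : False := by
  rcases x with (x | ⟨i1, j1⟩) <;> rcases y with (y | ⟨i2, j2⟩) <;> rcases z with (z | ⟨i3, j3⟩) <;>
    simp only [adj_cc, adj_cv, adj_vc, adj_vv] at h1 h2 h3 <;> grind

/-- `x` is a leaf with neighbour `y`. -/
def IsLf {V : Type} (G : SimpleGraph V) (x y : V) : Prop := ∀ z, G.Adj x z ↔ z = y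

theorem no_tail (n : ℕ) (x y z) (h1 : IsLf (Tfam (n+2)) x y)
    (h2 : ∀ w, (Tfam (n+2)).Adj y w ↔ w = x ∨ w = z) : False := by
  rcases x with (x | ⟨i1, j1⟩)
  · have a := (h1 (vv 0 0)).1 (by simp [adj_cv])
    have b := (h1 (vv 1 0)).1 (by simp [adj_cv])
    rw [← a] at b
    simp at b
  · by_cases hj : j1 = 0
    · subst hj
      have a := (h1 (vv i1 1)).1 (by simp [adj_vv])
      have b := (h1 (vv i1 2)).1 (by simp [adj_vv])
      rw [← a] at b
      simp at b
    · have a := (h1 (vv i1 0)).1 (by simp [adj_vv, hj])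
      subst a
      have b := (h2 (cc n)).1 (by simp [adj_vc])
      have c := (h2 (vv i1 1)).1 (by simp [adj_vv])
      have d := (h2 (vv i1 2)).1 (by simp [adj_vv])
      grind

theorem exAA (n : ℕ) : ∃ (H : SimpleGraph (Unit ⊕ Fin (n+2) × Fin 3)) (f1 f2 : Sym2 _),
    f1 ∈ H.edgeSet ∧ f2 ∈ H.edgeSet ∧ f1 ≠ f2 ∧ IsEmpty (H ≃g Tfam (n+2)) ∧
    Nonempty (H.deleteEdges {f1} ≃g (Tfam (n+2)).deleteEdges {s(vv 0 0, vv 0 1)}) ∧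
    Nonempty (H.deleteEdges {f2} ≃g (Tfam (n+2)).deleteEdges {s(vv 0 0, vv 0 1)}) := by
  have adj := mv_adj (Tfam (n+2)) (vv 0 0) (vv 0 1) (cc n) (vv 0 2) (by simp)
  refine ⟨mv (Tfam (n+2)) (vv 0 0) (vv 0 1) (cc n) (vv 0 2), s(cc n, vv 0 2), s(cc n, vv 0 0),
    ?_, ?_, ?_, ⟨fun φ => ?_⟩, mv_del _ _ _ _ _ (by simp) (by simp [adj_cv]), ?_⟩
  · simp [adj]
  · simp [adj, adj_cv]
  · simp
  · apply tri_free n (φ (cc n)) (φ (vv 0 0)) (φ (vv 0 2)) <;>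
    simp [φ.map_rel_iff, adj, adj_cv, adj_vv]
  · apply delIso _ _ (Equiv.swap (vv 0 0) (vv 0 2))
    have sw0 : ∀ j : Fin 3, Equiv.swap (vv (0 : Fin (n+2)) 0) (vv 0 2) (Sum.inr (0, j)) =
        vv 0 (Equiv.swap 0 2 j) := by
      intro j
      rcases fin3 j with rfl | rfl | rfl <;> simp [Equiv.swap_apply_def]
    have swc : ∀ x, Equiv.swap (vv (0 : Fin (n+2)) 0) (vv 0 2) (Sum.inl x) = cc n := by
      intro x; simp [Equiv.swap_apply_def]
    have sw1 : ∀ (i : Fin (n+2)) (j : Fin 3), i ≠ 0 →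
        Equiv.swap (vv (0 : Fin (n+2)) 0) (vv 0 2) (Sum.inr (i, j)) = vv i j := by
      intro i j hi; simp [Equiv.swap_apply_def, hi]
    intro u v
    rw [adj]
    rcases u with (x | ⟨i1, j1⟩) <;> rcases v with (y | ⟨i2, j2⟩)
    · simp [swc, adj_cc]
    · by_cases h2 : i2 = 0
      · subst h2
        rw [swc, sw0]
        rcases fin3 j2 with rfl | rfl | rfl <;> simp [adj_cv, Equiv.swap_apply_def]
      · rw [swc, sw1 _ _ h2]
        simp [adj_cv, h2]
    · by_cases h1 : i1 = 0
      · subst h1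
        rw [swc, sw0]
        rcases fin3 j1 with rfl | rfl | rfl <;> simp [adj_vc, Equiv.swap_apply_def]
      · rw [swc, sw1 _ _ h1]
        simp [adj_vc, h1]
    · by_cases h1 : i1 = 0 <;> by_cases h2 : i2 = 0
      · subst h1 h2
        rw [sw0, sw0]
        rcases fin3 j1 with rfl | rfl | rfl <;> rcases fin3 j2 with rfl | rfl | rfl <;>
          simp [adj_vv, Equiv.swap_apply_def]
      · subst h1
        rw [sw0, sw1 _ _ h2]
        simp [adj_vv, h2, Ne.symm h2]
      · subst h2
        rw [sw0, sw1 _ _ h1]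
        simp [adj_vv, h1]
      · rw [sw1 _ _ h1, sw1 _ _ h2]
        simp [adj_vv, h1, h2]

theorem exBB (n : ℕ) : ∃ (H : SimpleGraph (Unit ⊕ Fin (n+2) × Fin 3)) (f1 f2 : Sym2 _),
    f1 ∈ H.edgeSet ∧ f2 ∈ H.edgeSet ∧ f1 ≠ f2 ∧ IsEmpty (H ≃g Tfam (n+2)) ∧
    Nonempty (H.deleteEdges {f1} ≃g (Tfam (n+2)).deleteEdges {s(cc n, vv 0 0)}) ∧
    Nonempty (H.deleteEdges {f2} ≃g (Tfam (n+2)).deleteEdges {s(cc n, vv 0 0)}) := by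
  have adj := mv_adj (Tfam (n+2)) (cc n) (vv 0 0) (vv 0 1) (vv 0 2) (by simp)
  refine ⟨mv (Tfam (n+2)) (cc n) (vv 0 0) (vv 0 1) (vv 0 2), s(vv 0 1, vv 0 2), s(vv 0 0, vv 0 1),
    ?_, ?_, ?_, ⟨fun φ => ?_⟩, mv_del _ _ _ _ _ (by simp) (by simp [adj_vv]), ?_⟩
  · simp [adj]
  · simp [adj, adj_vv]
  · simp
  · apply tri_free n (φ (vv 0 1)) (φ (vv 0 0)) (φ (vv 0 2)) <;>
    simp [φ.map_rel_iff, adj, adj_vv]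
  · apply delIso _ _ (Equiv.swap (vv 0 0) (vv 0 2))
    have sw0 : ∀ j : Fin 3, Equiv.swap (vv (0 : Fin (n+2)) 0) (vv 0 2) (Sum.inr (0, j)) =
        vv 0 (Equiv.swap 0 2 j) := by
      intro j
      rcases fin3 j with rfl | rfl | rfl <;> simp [Equiv.swap_apply_def]
    have swc : ∀ x, Equiv.swap (vv (0 : Fin (n+2)) 0) (vv 0 2) (Sum.inl x) = cc n := by
      intro x; simp [Equiv.swap_apply_def]
    have sw1 : ∀ (i : Fin (n+2)) (j : Fin 3), i ≠ 0 →
        Equiv.swap (vv (0 : Fin (n+2)) 0) (vv 0 2) (Sum.inr (i, j)) = vv i j := by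
      intro i j hi; simp [Equiv.swap_apply_def, hi]
    intro u v
    rw [adj]
    rcases u with (x | ⟨i1, j1⟩) <;> rcases v with (y | ⟨i2, j2⟩)
    · simp [swc, adj_cc]
    · by_cases h2 : i2 = 0
      · subst h2
        rw [swc, sw0]
        rcases fin3 j2 with rfl | rfl | rfl <;> simp [adj_cv, Equiv.swap_apply_def]
      · rw [swc, sw1 _ _ h2]
        simp [adj_cv, h2]
    · by_cases h1 : i1 = 0
      · subst h1
        rw [swc, sw0]
        rcases fin3 j1 with rfl | rfl | rfl <;> simp [adj_vc, Equiv.swap_apply_def]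
      · rw [swc, sw1 _ _ h1]
        simp [adj_vc, h1]
    · by_cases h1 : i1 = 0 <;> by_cases h2 : i2 = 0
      · subst h1 h2
        rw [sw0, sw0]
        rcases fin3 j1 with rfl | rfl | rfl <;> rcases fin3 j2 with rfl | rfl | rfl <;>
          simp [adj_vv, Equiv.swap_apply_def]
      · subst h1
        rw [sw0, sw1 _ _ h2]
        simp [adj_vv, h2, Ne.symm h2]
      · subst h2
        rw [sw0, sw1 _ _ h1]
        simp [adj_vv, h1]
      · rw [sw1 _ _ h1, sw1 _ _ h2]
        simp [adj_vv, h1, h2]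

theorem exAB (n : ℕ) : ∃ (H : SimpleGraph (Unit ⊕ Fin (n+2) × Fin 3)) (f1 f2 : Sym2 _),
    f1 ∈ H.edgeSet ∧ f2 ∈ H.edgeSet ∧ f1 ≠ f2 ∧ IsEmpty (H ≃g Tfam (n+2)) ∧
    Nonempty (H.deleteEdges {f1} ≃g (Tfam (n+2)).deleteEdges {s(vv 0 0, vv 0 1)}) ∧
    Nonempty (H.deleteEdges {f2} ≃g (Tfam (n+2)).deleteEdges {s(cc n, vv 0 0)}) := by
  have adj := mv_adj (Tfam (n+2)) (vv 0 0) (vv 0 1) (vv 0 2) (vv 0 1) (by simp)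
  refine ⟨mv (Tfam (n+2)) (vv 0 0) (vv 0 1) (vv 0 2) (vv 0 1), s(vv 0 2, vv 0 1), s(cc n, vv 0 0),
    ?_, ?_, ?_, ⟨fun φ => ?_⟩, mv_del _ _ _ _ _ (by simp) (by simp [adj_vv]), ?_⟩
  · simp [adj]
  · simp [adj, adj_cv]
  · simp
  · apply no_tail n (φ (vv 0 1)) (φ (vv 0 2)) (φ (vv 0 0))
    · intro z
      obtain ⟨z, rfl⟩ := φ.surjective z
      rw [φ.map_rel_iff, adj, φ.injective.eq_iff]
      rcases z with (x | ⟨i1, j1⟩)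
      · simp [adj_vc]
      · simp [adj_vv]; grind
    · intro z
      obtain ⟨z, rfl⟩ := φ.surjective z
      rw [φ.map_rel_iff, adj, φ.injective.eq_iff, φ.injective.eq_iff]
      rcases z with (x | ⟨i1, j1⟩)
      · simp [adj_vc]
      · simp [adj_vv]; grind
  · apply delIso _ _ (Equiv.swap (vv 0 0) (vv 0 2))
    have sw0 : ∀ j : Fin 3, Equiv.swap (vv (0 : Fin (n+2)) 0) (vv 0 2) (Sum.inr (0, j)) =
        vv 0 (Equiv.swap 0 2 j) := by
      intro j
      rcases fin3 j with rfl | rfl | rfl <;> simp [Equiv.swap_apply_def]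
    have swc : ∀ x, Equiv.swap (vv (0 : Fin (n+2)) 0) (vv 0 2) (Sum.inl x) = cc n := by
      intro x; simp [Equiv.swap_apply_def]
    have sw1 : ∀ (i : Fin (n+2)) (j : Fin 3), i ≠ 0 →
        Equiv.swap (vv (0 : Fin (n+2)) 0) (vv 0 2) (Sum.inr (i, j)) = vv i j := by
      intro i j hi; simp [Equiv.swap_apply_def, hi]
    intro u v
    rw [adj]
    rcases u with (x | ⟨i1, j1⟩) <;> rcases v with (y | ⟨i2, j2⟩)
    · simp [swc, adj_cc]
    · by_cases h2 : i2 = 0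
      · subst h2
        rw [swc, sw0]
        rcases fin3 j2 with rfl | rfl | rfl <;> simp [adj_cv, Equiv.swap_apply_def]
      · rw [swc, sw1 _ _ h2]
        simp [adj_cv, h2]
    · by_cases h1 : i1 = 0
      · subst h1
        rw [swc, sw0]
        rcases fin3 j1 with rfl | rfl | rfl <;> simp [adj_vc, Equiv.swap_apply_def]
      · rw [swc, sw1 _ _ h1]
        simp [adj_vc, h1]
    · by_cases h1 : i1 = 0 <;> by_cases h2 : i2 = 0
      · subst h1 h2
        rw [sw0, sw0]
        rcases fin3 j1 with rfl | rfl | rfl <;> rcases fin3 j2 with rfl | rfl | rfl <;>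
          simp [adj_vv, Equiv.swap_apply_def]
      · subst h1
        rw [sw0, sw1 _ _ h2]
        simp [adj_vv, h2, Ne.symm h2]
      · subst h2
        rw [sw0, sw1 _ _ h1]
        simp [adj_vv, h1]
      · rw [sw1 _ _ h1, sw1 _ _ h2]
        simp [adj_vv, h1, h2]

theorem pair_ex (n : ℕ) (e1 e2) (h1 : e1 ∈ (Tfam (n+2)).edgeSet) (h2 : e2 ∈ (Tfam (n+2)).edgeSet) :
    ∃ (H : SimpleGraph (Unit ⊕ Fin (n+2) × Fin 3)) (f1 f2 : Sym2 _),
    f1 ∈ H.edgeSet ∧ f2 ∈ H.edgeSet ∧ f1 ≠ f2 ∧ IsEmpty (H ≃g Tfam (n+2)) ∧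
    Nonempty (H.deleteEdges {f1} ≃g (Tfam (n+2)).deleteEdges {e1}) ∧
    Nonempty (H.deleteEdges {f2} ≃g (Tfam (n+2)).deleteEdges {e2}) := by
  rcases edge_std n e1 h1 with ⟨⟨a⟩⟩ | ⟨⟨a⟩⟩ <;> rcases edge_std n e2 h2 with ⟨⟨b⟩⟩ | ⟨⟨b⟩⟩
  · obtain ⟨H, f1, f2, q1, q2, q3, q4, ⟨q5⟩, ⟨q6⟩⟩ := exAA n
    exact ⟨H, f1, f2, q1, q2, q3, q4, ⟨q5.trans a⟩, ⟨q6.trans b⟩⟩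
  · obtain ⟨H, f1, f2, q1, q2, q3, q4, ⟨q5⟩, ⟨q6⟩⟩ := exAB n
    exact ⟨H, f1, f2, q1, q2, q3, q4, ⟨q5.trans a⟩, ⟨q6.trans b⟩⟩
  · obtain ⟨H, f1, f2, q1, q2, q3, q4, ⟨q5⟩, ⟨q6⟩⟩ := exAB n
    exact ⟨H, f2, f1, q2, q1, q3.symm, q4, ⟨q6.trans a⟩, ⟨q5.trans b⟩⟩
  · obtain ⟨H, f1, f2, q1, q2, q3, q4, ⟨q5⟩, ⟨q6⟩⟩ := exBB n
    exact ⟨H, f1, f2, q1, q2, q3, q4, ⟨q5.trans a⟩, ⟨q6.trans b⟩⟩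

/-- Properties of the card `T_k - (central edge)`. -/
structure PB {V : Type} (G : SimpleGraph V) : Prop where
  noiso : ∀ x, ∃ y, G.Adj x y
  sib : ∀ x y, IsLf G x y → ∃ z, z ≠ x ∧ IsLf G z y

theorem PB.iso {V W : Type} {G : SimpleGraph V} {H : SimpleGraph W} (h : PB G) (φ : H ≃g G) :
    PB H := by
  constructor
  · intro x
    obtain ⟨y, hy⟩ := h.noiso (φ x)
    refine ⟨φ.symm y, ?_⟩
    rw [← φ.map_rel_iff]; simpa using hy
  · intro x y hxy
    obtain ⟨z, hz, hl⟩ := h.sib (φ x) (φ y) (by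
      intro z
      obtain ⟨z, rfl⟩ := φ.surjective z
      rw [φ.map_rel_iff, hxy z, φ.injective.eq_iff])
    obtain ⟨z, rfl⟩ := φ.surjective z
    refine ⟨z, fun h => hz (by rw [h]), fun w => ?_⟩
    rw [← φ.map_rel_iff, hl, φ.injective.eq_iff]

theorem PB_card (n : ℕ) (i : Fin (n+2)) : PB ((Tfam (n+2)).deleteEdges {s(cc n, vv i 0)}) := by
  have hadj : ∀ u v, ((Tfam (n+2)).deleteEdges {s(cc n, vv i 0)}).Adj u v ↔
      (Tfam (n+2)).Adj u v ∧ s(u, v) ≠ s(cc n, vv i 0) := by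
    intro u v; simp [SimpleGraph.deleteEdges_adj]
  have hoth : ∃ i' : Fin (n+2), i' ≠ i := exists_ne i
  obtain ⟨i', hi'⟩ := hoth
  constructor
  · rintro (x | ⟨i1, j1⟩)
    · exact ⟨vv i' 0, by simp [hadj, adj_cv, hi']⟩
    · by_cases hj : j1 = 0
      · exact ⟨vv i1 1, by simp [hadj, adj_vv, hj]⟩
      · exact ⟨vv i1 0, by simp [hadj, adj_vv, hj]⟩
  · rintro (x | ⟨i1, j1⟩) y hxy
    · have a := (hxy (vv i' 0)).1 (by simp [hadj, adj_cv, hi'])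
      subst a
      refine ⟨vv i' 1, by simp, ?_⟩
      rintro (w | ⟨i2, j2⟩)
      · simp [hadj, adj_vc]
      · simp [hadj, adj_vv]; grind
    · by_cases hj : j1 = 0
      · subst hj
        have a := (hxy (vv i1 1)).1 (by simp [hadj, adj_vv])
        have b := (hxy (vv i1 2)).1 (by simp [hadj, adj_vv])
        rw [← a] at b
        simp at b
      · have a := (hxy (vv i1 0)).1 (by simp [hadj, adj_vv, hj])
        subst a
        obtain ⟨j2, h2, h3⟩ : ∃ j2 : Fin 3, j2 ≠ 0 ∧ j2 ≠ j1 := by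
          rcases fin3 j1 with rfl | rfl | rfl
          · exact absurd rfl hj
          · exact ⟨2, by decide, by decide⟩
          · exact ⟨1, by decide, by decide⟩
        refine ⟨vv i1 j2, by simp [h3], ?_⟩
        rintro (w | ⟨i2, j3⟩)
        · simp [hadj, adj_vc, h2]
        · simp [hadj, adj_vv]; grind

/-- Two different edges whose deletion has property `PB` cannot coexist with a tail. -/
theorem tail_contra {W : Type} (H : SimpleGraph W) (f1 f2 : Sym2 W) (hf : f1 ≠ f2)
    (h1 : PB (H.deleteEdges {f1})) (h2 : PB (H.deleteEdges {f2})) (x y z w : W)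
    (hx : IsLf H x y) (hy : ∀ u, H.Adj y u ↔ u = x ∨ u = z) (hz : H.Adj z w) (hw : w ≠ y) :
    False := by
  have key : ∀ f, PB (H.deleteEdges {f}) → f = s(z, w) := by
    intro f hP
    have hadj : ∀ u v, (H.deleteEdges {f}).Adj u v ↔ H.Adj u v ∧ s(u, v) ≠ f := by
      intro u v; simp [SimpleGraph.deleteEdges_adj]
    obtain ⟨y', hy'⟩ := hP.noiso x
    have e : y' = y := (hx y').1 ((hadj _ _).1 hy').1
    subst e
    obtain ⟨t, ht, hl⟩ := hP.sib x y' (by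
      intro v
      constructor
      · intro h; exact (hx v).1 ((hadj _ _).1 h).1
      · rintro rfl; exact hy')
    have : t = z := by
      have := (hl y').2 rfl
      have := ((hadj _ _).1 this).1.symm
      rcases (hy t).1 this with h | h
      · exact absurd h ht
      · exact h
    subst this
    by_contra hne
    exact hw ((hl w).1 ((hadj _ _).2 ⟨hz, fun h => hne h.symm⟩))
  exact hf ((key f1 h1).trans (key f2 h2).symm)

theorem recon (n : ℕ) (W : Type) (H : SimpleGraph W) (e f1 f2 : Sym2 W) (he : e ∈ H.edgeSet)
    (hf : f1 ≠ f2)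
    (φ : H.deleteEdges {e} ≃g (Tfam (n+2)).deleteEdges {s(vv 0 0, vv 0 1)})
    (h1 : PB (H.deleteEdges {f1})) (h2 : PB (H.deleteEdges {f2})) :
    Nonempty (H ≃g Tfam (n+2)) := by
  obtain ⟨p, q, hpq, hepq⟩ : ∃ p q, p ≠ q ∧ e = s(φ.symm p, φ.symm q) := by
    induction e using Sym2.ind with
    | _ p q =>
      refine ⟨φ p, φ q, ?_, by simp⟩
      exact fun h => (H.ne_of_adj he) (φ.injective h)
  have adj : ∀ u v, H.Adj (φ.symm u) (φ.symm v) ↔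
      ((Tfam (n+2)).Adj u v ∧ s(u, v) ≠ s(vv 0 0, vv 0 1)) ∨ s(u, v) = s(p, q) := by
    intro u v
    have h3 := φ.symm.map_rel_iff (a := u) (b := v)
    have h4 : s(φ.symm u, φ.symm v) = s(φ.symm p, φ.symm q) ↔ s(u, v) = s(p, q) := by
      exact (Sym2.map.injective φ.symm.injective).eq_iff (a := s(u, v)) (b := s(p, q))
    simp only [SimpleGraph.deleteEdges_adj, Set.mem_singleton_iff, hepq, h4] at h3
    have h5 : s(u, v) = s(p, q) → H.Adj (φ.symm u) (φ.symm v) := by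
      intro h
      rw [← SimpleGraph.mem_edgeSet, h4.2 h, ← hepq]; exact he
    tauto
  clear he
  -- the isolated vertex lies on the new edge
  obtain ⟨y, hy⟩ : ∃ y, s(p, q) = s(vv 0 1, y) := by
    obtain ⟨y', hy'⟩ := h1.noiso (φ.symm (vv 0 1))
    obtain ⟨y, rfl⟩ := φ.symm.surjective y'
    have h3 : H.Adj (φ.symm (vv 0 1)) (φ.symm y) := by
      simp only [SimpleGraph.deleteEdges_adj] at hy'
      exact hy'.1
    rw [adj] at h3
    rcases h3 with ⟨h3, h4⟩ | h3
    · exfalso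
      rcases y with (y | ⟨i, j⟩)
      · simp [adj_vc] at h3
      · simp [adj_vv] at h3
        obtain ⟨rfl, rfl⟩ := h3
        exact h4 Sym2.eq_swap
    · exact ⟨y, h3.symm⟩
  have hy1 : y ≠ vv 0 1 := by
    rintro rfl
    apply hpq
    grind
  rw [hy] at adj
  clear hy
  by_cases c1 : y = vv 0 0
  · subst c1
    refine ⟨⟨φ.toEquiv, ?_⟩⟩
    intro u v
    have := adj (φ u) (φ v)
    simp only [RelIso.symm_apply_apply] at this
    rw [this]
    have : s(φ u, φ v) = s(vv 0 1, vv 0 0) → (Tfam (n+2)).Adj (φ u) (φ v) := by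
      intro h
      rw [← SimpleGraph.mem_edgeSet, h]; simp [adj_vv]
    have hsw : (s(vv 0 0, vv 0 1) : Sym2 (Unit ⊕ Fin (n+2) × Fin 3)) = s(vv 0 1, vv 0 0) :=
      Sym2.eq_swap
    have hsw' : s(φ u, φ v) = s(vv 0 0, vv 0 1) ↔ s(φ u, φ v) = s(vv 0 1, vv 0 0) :=
      ⟨fun h => h.trans hsw, fun h => h.trans hsw.symm⟩
    change (Tfam (n+2)).Adj (φ u) (φ v) ↔ _
    tauto
  · exfalso
    by_cases c2 : y = vv 0 2
    · subst c2
      refine tail_contra H f1 f2 hf h1 h2 (φ.symm (vv 0 1)) (φ.symm (vv 0 2)) (φ.symm (vv 0 0))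
        (φ.symm (cc n)) ?_ ?_ ?_ ?_
      · intro u'
        obtain ⟨u, rfl⟩ := φ.symm.surjective u'
        rw [adj, φ.symm.injective.eq_iff]
        rcases u with (u | ⟨i, j⟩)
        · simp [adj_vc]
        · simp [adj_vv]; grind
      · intro u'
        obtain ⟨u, rfl⟩ := φ.symm.surjective u'
        rw [adj, φ.symm.injective.eq_iff, φ.symm.injective.eq_iff]
        rcases u with (u | ⟨i, j⟩)
        · simp [adj_vc]
        · simp [adj_vv]; grind
      · rw [adj]; simp [adj_vc]
      · rw [φ.symm.injective.ne_iff]; simp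
    · refine tail_contra H f1 f2 hf h1 h2 (φ.symm (vv 0 2)) (φ.symm (vv 0 0)) (φ.symm (cc n))
        (φ.symm (vv 1 0)) ?_ ?_ ?_ ?_
      · intro u'
        obtain ⟨u, rfl⟩ := φ.symm.surjective u'
        rw [adj, φ.symm.injective.eq_iff]
        rcases u with (u | ⟨i, j⟩)
        · simp [adj_vc]
        · simp [adj_vv]; grind
      · intro u'
        obtain ⟨u, rfl⟩ := φ.symm.surjective u'
        rw [adj, φ.symm.injective.eq_iff, φ.symm.injective.eq_iff]
        rcases u with (u | ⟨i, j⟩)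
        · simp [adj_vc]
        · rcases fin3 j with rfl | rfl | rfl <;> simp [adj_vv] <;> grind
      · rw [adj]; simp [adj_cv]
      · rw [φ.symm.injective.ne_iff]; simp

/-- For every `k ≥ 2`, the tree `T_k` has edge-reconstruction number 3. -/
theorem stmt12 (k : ℕ) (hk : 2 ≤ k) : ern (Tfam k) = 3 := by
  obtain ⟨n, rfl⟩ : ∃ n, k = n + 2 := ⟨k - 2, by omega⟩
  classical
  unfold ern
  refine IsLeast.csInf_eq ⟨?_, ?_⟩
  · let e0 : Sym2 (Unit ⊕ Fin (n+2) × Fin 3) := s(vv 0 0, vv 0 1)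
    let e1 : Sym2 (Unit ⊕ Fin (n+2) × Fin 3) := s(cc n, vv 0 0)
    let e2 : Sym2 (Unit ⊕ Fin (n+2) × Fin 3) := s(cc n, vv 1 0)
    refine ⟨{e0, e1, e2}, ?_, ?_, ?_⟩
    · rw [Finset.card_eq_three]
      exact ⟨e0, e1, e2, by simp [e0, e1], by simp [e0, e2], by simp [e1, e2], rfl⟩
    · intro e he
      simp only [Finset.coe_insert, Finset.coe_singleton, Set.mem_insert_iff,
        Set.mem_singleton_iff] at he
      rcases he with rfl | rfl | rfl
      · simp [e0, adj_vv]
      · simp [e1, adj_cv]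
      · simp [e2, adj_cv]
    · intro W _ H t ht ⟨φ, hφ⟩
      have m0 : e0 ∈ ({e0, e1, e2} : Finset _) := by simp
      have m1 : e1 ∈ ({e0, e1, e2} : Finset _) := by simp
      have m2 : e2 ∈ ({e0, e1, e2} : Finset _) := by simp
      obtain ⟨ψ0⟩ := hφ ⟨e0, m0⟩
      obtain ⟨ψ1⟩ := hφ ⟨e1, m1⟩
      obtain ⟨ψ2⟩ := hφ ⟨e2, m2⟩
      refine recon n W H (φ ⟨e0, m0⟩).1 (φ ⟨e1, m1⟩).1 (φ ⟨e2, m2⟩).1 (ht (φ ⟨e0, m0⟩).2) ?_ ψ0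
        ((PB_card n 0).iso ψ1) ((PB_card n 1).iso ψ2)
      intro h
      have h' := φ.injective (Subtype.ext h)
      simp [e1, e2] at h'
  · rintro m ⟨s, hs, hsub, hrec⟩
    by_contra hlt
    have hle : s.card ≤ 2 := by omega
    obtain ⟨e1, e2, hE1, hE2, hne, hcov⟩ : ∃ e1 e2, e1 ∈ (Tfam (n+2)).edgeSet ∧
        e2 ∈ (Tfam (n+2)).edgeSet ∧ e1 ≠ e2 ∧ ∀ e ∈ s, e = e1 ∨ e = e2 := by
      have ha : s(cc n, vv 0 0) ∈ (Tfam (n+2)).edgeSet := by simp [adj_cv]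
      have hb : s(cc n, vv 1 0) ∈ (Tfam (n+2)).edgeSet := by simp [adj_cv]
      have hab : s(cc n, vv 0 0) ≠ s(cc n, vv 1 0) := by simp
      have hc : s.card = 0 ∨ s.card = 1 ∨ s.card = 2 := by omega
      rcases hc with hc | hc | hc
      · rw [Finset.card_eq_zero] at hc
        exact ⟨_, _, ha, hb, hab, by simp [hc]⟩
      · rw [Finset.card_eq_one] at hc
        obtain ⟨x, rfl⟩ := hc
        have hx : x ∈ (Tfam (n+2)).edgeSet := hsub (by simp)
        by_cases hxa : x = s(cc n, vv 0 0)
        · exact ⟨x, _, hx, hb, hxa ▸ hab, by simp⟩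
        · exact ⟨x, _, hx, ha, hxa, by simp⟩
      · rw [Finset.card_eq_two] at hc
        obtain ⟨x, y, hxy, rfl⟩ := hc
        exact ⟨x, y, hsub (by simp), hsub (by simp), hxy, by simp⟩
    obtain ⟨H, f1, f2, q1, q2, q3, q4, q5, q6⟩ := pair_ex n e1 e2 hE1 hE2
    let F : Sym2 (Unit ⊕ Fin (n+2) × Fin 3) → Sym2 (Unit ⊕ Fin (n+2) × Fin 3) :=
      fun e => if e = e1 then f1 else f2
    have F1 : F e1 = f1 := by simp [F]
    have F2 : F e2 = f2 := by simp [F, hne.symm]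
    have hinj : ∀ x ∈ s, ∀ y ∈ s, F x = F y → x = y := by
      intro x hx y hy h
      rcases hcov x hx with rfl | rfl <;> rcases hcov y hy with rfl | rfl
      · rfl
      · rw [F1, F2] at h; exact absurd h q3
      · rw [F1, F2] at h; exact absurd h.symm q3
      · rfl
    apply not_nonempty_iff.2 q4
    refine hrec _ inferInstance H (s.image F) ?_ ?_
    · intro f hf
      simp only [Finset.coe_image, Set.mem_image, Finset.mem_coe] at hf
      obtain ⟨e, he, rfl⟩ := hf
      rcases hcov e he with rfl | rfl
      · rw [F1]; exact q1
      · rw [F2]; exact q2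
    · let g : {e // e ∈ s} → {f // f ∈ s.image F} :=
        fun e => ⟨F e.1, Finset.mem_image_of_mem F e.2⟩
      have hg : Function.Bijective g := by
        constructor
        · intro a b h
          exact Subtype.ext (hinj _ a.2 _ b.2 (congrArg Subtype.val h))
        · rintro ⟨f, hf⟩
          obtain ⟨e, he, rfl⟩ := Finset.mem_image.1 hf
          exact ⟨⟨e, he⟩, rfl⟩
      refine ⟨Equiv.ofBijective g hg, ?_⟩
      rintro ⟨e, he⟩
      change Nonempty (H.deleteEdges {F e} ≃g _)
      rcases hcov e he with rfl | rfl
      · rw [F1]; exact q5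
      · rw [F2]; exact q6

end ErnPaper
end

section
/- Let T be a finite bicentroidal tree whose two centroidal components are both isomorphic to the path P_k, where k > 5. Then ern(T) = 2. -/
open SimpleGraph

namespace ErnPaper

/-- unordered pair equality on naturals -/
def pr (a b c d : ℕ) : Prop := (a = c ∧ b = d) ∨ (a = d ∧ b = c)

/-- adjacency of two paths `0..k-1`, `k..2k-1` joined by the edge `i, k+j`. -/
def dadj (k i j a b : ℕ) : Prop :=
  (b = a + 1 ∧ b ≠ k) ∨ (a = b + 1 ∧ a ≠ k) ∨ pr a b i (k + j)

def cadj (k i j c d a b : ℕ) : Prop := dadj k i j a b ∧ ¬ pr a b c d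

def kadj (k i j c d r q f g a b : ℕ) : Prop :=
  (cadj k i j c d a b ∨ pr a b r q) ∧ ¬ pr a b f g

/-- no vertex of degree at least three -/
def NoDeg3 (n : ℕ) (A : ℕ → ℕ → Prop) : Prop :=
  ∀ v a b c, v < n → a < n → b < n → c < n → a ≠ b → a ≠ c → b ≠ c →
    A v a → A v b → A v c → False

/-- sizes of certain sets that are closed under adjacency -/
def ClosedSz (n p : ℕ) (A : ℕ → ℕ → Prop) : Prop :=
  ∀ m a b, m ≤ a → a ≤ b → b ≤ n →
    (∀ s t, s < n → t < n → A s t → (s < m ∨ (a ≤ s ∧ s < b)) → (t < m ∨ (a ≤ t ∧ t < b))) →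
    m + (b - a) = 0 ∨ m + (b - a) = p ∨ m + (b - a) = n - p ∨ m + (b - a) = n


section
variable {k i j c d r q f g : ℕ}

lemma k_up {a : ℕ} (h : a + 1 ≠ k) (h1 : ¬ (a = c ∧ a + 1 = d ∨ a = d ∧ a + 1 = c))
    (h2 : ¬ (f = a ∧ g = a + 1 ∨ f = a + 1 ∧ g = a)) :
    kadj k i j c d r q f g a (a+1) := by
  refine ⟨Or.inl ⟨Or.inl ⟨rfl, h⟩, h1⟩, ?_⟩
  simp only [pr]; omega

lemma k_symm {a b : ℕ} (h : kadj k i j c d r q f g a b) : kadj k i j c d r q f g b a := by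
  obtain ⟨h1, h2⟩ := h
  refine ⟨?_, by simp only [pr] at *; omega⟩
  rcases h1 with ⟨h1, h3⟩ | h1
  · refine Or.inl ⟨?_, by simp only [pr] at *; omega⟩
    rcases h1 with h1 | h1 | h1
    · exact Or.inr (Or.inl h1)
    · exact Or.inl h1
    · refine Or.inr (Or.inr ?_)
      simp only [pr] at *; omega
  · refine Or.inr ?_
    simp only [pr] at *; omega

lemma k_dn {a : ℕ} (h0 : 0 < a) (h : a ≠ k) (h1 : ¬ (a - 1 = c ∧ a = d ∨ a - 1 = d ∧ a = c))
    (h2 : ¬ (f = a ∧ g = a - 1 ∨ f = a - 1 ∧ g = a)) :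
    kadj k i j c d r q f g a (a-1) := by
  obtain ⟨b, rfl⟩ : ∃ b, a = b + 1 := ⟨a - 1, by omega⟩
  simp only [Nat.add_sub_cancel] at *
  exact k_symm (k_up h h1 (by omega))

lemma k_cen (h1 : ¬ (i = c ∧ k + j = d ∨ i = d ∧ k + j = c))
    (h2 : ¬ (f = i ∧ g = k + j ∨ f = k + j ∧ g = i)) :
    kadj k i j c d r q f g i (k+j) := by
  refine ⟨Or.inl ⟨Or.inr (Or.inr (Or.inl ⟨rfl, rfl⟩)), h1⟩, ?_⟩
  simp only [pr]; omega

lemma k_new (h2 : ¬ (f = r ∧ g = q ∨ f = q ∧ g = r)) :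
    kadj k i j c d r q f g r q := by
  refine ⟨Or.inr (Or.inl ⟨rfl, rfl⟩), ?_⟩
  simp only [pr]; omega

lemma closed_of {n : ℕ} (S : ℕ → Prop)
    (h1 : ∀ a, a + 1 < n → a + 1 ≠ k → ¬ (a = c ∧ a + 1 = d) → ¬ (f = a ∧ g = a + 1) →
      ¬ (f = a + 1 ∧ g = a) → (S a ↔ S (a+1)))
    (h2 : (f = i ∧ g = k + j) ∨ (f = k + j ∧ g = i) ∨ (c = i ∧ d = k + j) ∨ (S i ↔ S (k+j)))
    (h3 : (f = r ∧ g = q) ∨ (f = q ∧ g = r) ∨ (S r ↔ S q)) (s t : ℕ)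
    (hs : s < n) (ht : t < n) (h : kadj k i j c d r q f g s t) : S s → S t := by
  obtain ⟨h, hf⟩ := h
  simp only [pr] at hf
  rcases h with ⟨h, hc⟩ | h
  · simp only [pr] at hc
    rcases h with ⟨rfl, h⟩ | ⟨rfl, h⟩ | ⟨rfl, rfl⟩ | ⟨rfl, rfl⟩
    · exact (h1 s ht h (by omega) (by omega) (by omega)).1
    · exact (h1 t hs h (by omega) (by omega) (by omega)).2
    · rcases h2 with h2 | h2 | h2 | h2
      · omega
      · omega
      · omega
      · exact h2.1
    · rcases h2 with h2 | h2 | h2 | h2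
      · omega
      · omega
      · omega
      · exact h2.2
  · rcases h with ⟨rfl, rfl⟩ | ⟨rfl, rfl⟩
    · rcases h3 with h3 | h3 | h3
      · omega
      · omega
      · exact h3.1
    · rcases h3 with h3 | h3 | h3
      · omega
      · omega
      · exact h3.2

lemma cl_use {n p : ℕ} (hcl : ClosedSz n p (kadj k i j c d r q f g)) (m a b : ℕ)
    (hm : m ≤ a) (hab : a ≤ b) (hb : b ≤ n)
    (h1 : ∀ s, s + 1 < n → s + 1 ≠ k → ¬ (s = c ∧ s + 1 = d) → ¬ (f = s ∧ g = s + 1) →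
      ¬ (f = s + 1 ∧ g = s) → ((s < m ∨ (a ≤ s ∧ s < b)) ↔ (s + 1 < m ∨ (a ≤ s + 1 ∧ s + 1 < b))))
    (h2 : (f = i ∧ g = k + j) ∨ (f = k + j ∧ g = i) ∨ (c = i ∧ d = k + j) ∨
      ((i < m ∨ (a ≤ i ∧ i < b)) ↔ (k + j < m ∨ (a ≤ k + j ∧ k + j < b))))
    (h3 : (f = r ∧ g = q) ∨ (f = q ∧ g = r) ∨
      ((r < m ∨ (a ≤ r ∧ r < b)) ↔ (q < m ∨ (a ≤ q ∧ q < b)))) :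
    m + (b - a) = 0 ∨ m + (b - a) = p ∨ m + (b - a) = n - p ∨ m + (b - a) = n :=
  hcl m a b hm hab hb (fun s t hs ht h =>
    closed_of (fun s => s < m ∨ (a ≤ s ∧ s < b)) h1 h2 h3 s t hs ht h)

end


lemma sep {k i j c d r q f g m p : ℕ} (hm : 0 < m) (hmk : m ≤ k) (hp : 0 < p) (hpk : p ≤ k)
    (hmp : m ≠ p) (hi : i < k)
    (h : (m ≤ i ∧ c + 1 = m ∧ d = m) ∨ (m = k ∧ c = i ∧ d = k + j))
    (hcl : ClosedSz (2 * k) p (kadj k i j c d r q f g)) :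
    (r < m ∧ m ≤ q) ∨ (q < m ∧ m ≤ r) := by
  by_contra hcon
  have := cl_use hcl 0 0 m (by omega) (by omega) (by omega)
    (by intro s h0 h1 h2 h3 h4; omega) (by omega) (by omega)
  omega

set_option maxHeartbeats 4000000 in
lemma caseB {k i j r q f g m : ℕ} (hm : 0 < m) (hi : i + 1 < k) (hj : j < k)
    (hmi : m + (k - 1) = 2 * i) (hr : r < m) (hq : m ≤ q) (hq2 : q < 2 * k)
    (hdeg : NoDeg3 (2 * k) (kadj k i j (m - 1) m r q f g))
    (hcl : ClosedSz (2 * k) k (kadj k i j (m - 1) m r q f g)) :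
    (r = 0 ∨ r = m - 1) ∧ (q = m ∨ q = k - 1) := by
  have hff : (f = i ∧ g = i - 1 ∨ f = i - 1 ∧ g = i) ∨ (f = i ∧ g = i + 1 ∨ f = i + 1 ∧ g = i) ∨
      (f = i ∧ g = k + j ∨ f = k + j ∧ g = i) := by
    by_contra hcon
    exact hdeg i (i-1) (i+1) (k+j) (by lia) (by lia) (by lia) (by lia) (by lia)
      (by lia) (by lia) (k_dn (by lia) (by lia) (by lia) (by lia))
      (k_up (by lia) (by lia) (by lia)) (k_cen (by lia) (by lia))
  have hqi : q ≠ i := by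
    rintro rfl
    rcases hff with h | h | h
    · exact hdeg q r (q+1) (k+j) (by lia) (by lia) (by lia) (by lia) (by lia)
        (by lia) (by lia) (k_symm (k_new (by lia)))
        (k_up (by lia) (by lia) (by lia)) (k_cen (by lia) (by lia))
    · exact hdeg q r (q-1) (k+j) (by lia) (by lia) (by lia) (by lia) (by lia)
        (by lia) (by lia) (k_symm (k_new (by lia)))
        (k_dn (by lia) (by lia) (by lia) (by lia)) (k_cen (by lia) (by lia))
    · exact hdeg q r (q-1) (q+1) (by lia) (by lia) (by lia) (by lia) (by lia)
        (by lia) (by lia) (k_symm (k_new (by lia)))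
        (k_dn (by lia) (by lia) (by lia) (by lia)) (k_up (by lia) (by lia) (by lia))
  rcases hff with h | h | h
  · exfalso
    by_cases hin : m ≤ q ∧ q < i
    · have := cl_use hcl m m i (by lia) (by lia) (by lia)
        (by intro s h0 h1 h2 h3 h4; rcases h with h | h <;> lia) (by lia) (by lia)
      lia
    · have := cl_use hcl 0 m i (by lia) (by lia) (by lia)
        (by intro s h0 h1 h2 h3 h4; rcases h with h | h <;> lia) (by lia) (by lia)
      lia
  · exfalso
    by_cases hin : i + 1 ≤ q ∧ q < k
    · have := cl_use hcl m (i+1) k (by lia) (by lia) (by lia)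
        (by intro s h0 h1 h2 h3 h4; rcases h with h | h <;> lia) (by lia) (by lia)
      lia
    · have := cl_use hcl 0 (i+1) k (by lia) (by lia) (by lia)
        (by intro s h0 h1 h2 h3 h4; rcases h with h | h <;> lia) (by lia) (by lia)
      lia
  · have hin : q < k := by
      by_contra hin
      have := cl_use hcl 0 m k (by lia) (by lia) (by lia)
        (by intro s h0 h1 h2 h3 h4; rcases h with h | h <;> lia) (by lia) (by lia)
      lia
    constructor
    · by_contra hcon
      exact hdeg r (r-1) (r+1) q (by lia) (by lia) (by lia) (by lia) (by lia)
        (by lia) (by lia) (k_dn (by lia) (by lia) (by lia) (by lia))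
        (k_up (by lia) (by lia) (by lia)) (k_new (by lia))
    · by_contra hcon
      exact hdeg q (q-1) (q+1) r (by lia) (by lia) (by lia) (by lia) (by lia)
        (by lia) (by lia) (k_dn (by lia) (by lia) (by lia) (by lia))
        (k_up (by lia) (by lia) (by lia)) (k_symm (k_new (by lia)))

set_option maxHeartbeats 4000000 in
lemma caseI {k j r q f g : ℕ} (hk : 5 < k) (hj : 2 * j + 1 = k)
    (hr : r < k - 1) (hq : k - 1 ≤ q) (hq2 : q < 2 * k)
    (hdeg : NoDeg3 (2 * k) (kadj k (k-1) j (k - 1 - 1) (k-1) r q f g))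
    (hcl : ClosedSz (2 * k) k (kadj k (k-1) j (k - 1 - 1) (k-1) r q f g)) :
    (r = 0 ∨ r = k - 1 - 1) ∧ (q = k - 1) := by
  have hff : (f = k + j ∧ g = k + j - 1 ∨ f = k + j - 1 ∧ g = k + j) ∨
      (f = k + j ∧ g = k + j + 1 ∨ f = k + j + 1 ∧ g = k + j) ∨
      (f = k - 1 ∧ g = k + j ∨ f = k + j ∧ g = k - 1) := by
    by_contra hcon
    exact hdeg (k+j) (k+j-1) (k+j+1) (k-1) (by lia) (by lia) (by lia) (by lia) (by lia)
      (by lia) (by lia) (k_dn (by lia) (by lia) (by lia) (by lia))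
      (k_up (by lia) (by lia) (by lia)) (k_symm (k_cen (by lia) (by lia)))
  have hqi : q ≠ k + j := by
    rintro rfl
    rcases hff with h | h | h
    · exact hdeg (k+j) r (k+j+1) (k-1) (by lia) (by lia) (by lia) (by lia) (by lia)
        (by lia) (by lia) (k_symm (k_new (by lia)))
        (k_up (by lia) (by lia) (by lia)) (k_symm (k_cen (by lia) (by lia)))
    · exact hdeg (k+j) r (k+j-1) (k-1) (by lia) (by lia) (by lia) (by lia) (by lia)
        (by lia) (by lia) (k_symm (k_new (by lia)))
        (k_dn (by lia) (by lia) (by lia) (by lia)) (k_symm (k_cen (by lia) (by lia)))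
    · exact hdeg (k+j) r (k+j-1) (k+j+1) (by lia) (by lia) (by lia) (by lia) (by lia)
        (by lia) (by lia) (k_symm (k_new (by lia)))
        (k_dn (by lia) (by lia) (by lia) (by lia)) (k_up (by lia) (by lia) (by lia))
  rcases hff with h | h | h
  · exfalso
    by_cases hin : k ≤ q ∧ q < k + j
    · have := cl_use hcl (k-1) k (k+j) (by lia) (by lia) (by lia)
        (by intro s h0 h1 h2 h3 h4; rcases h with h | h <;> lia) (by lia) (by lia)
      lia
    · have := cl_use hcl 0 k (k+j) (by lia) (by lia) (by lia)
        (by intro s h0 h1 h2 h3 h4; rcases h with h | h <;> lia) (by lia) (by lia)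
      lia
  · exfalso
    by_cases hin : k + j + 1 ≤ q
    · have := cl_use hcl (k-1) (k+j+1) (2*k) (by lia) (by lia) (by lia)
        (by intro s h0 h1 h2 h3 h4; rcases h with h | h <;> lia) (by lia) (by lia)
      lia
    · have := cl_use hcl 0 (k+j+1) (2*k) (by lia) (by lia) (by lia)
        (by intro s h0 h1 h2 h3 h4; rcases h with h | h <;> lia) (by lia) (by lia)
      lia
  · have hin : q = k - 1 := by
      by_contra hin
      have := cl_use hcl 0 (k-1) k (by lia) (by lia) (by lia)
        (by intro s h0 h1 h2 h3 h4; rcases h with h | h <;> lia) (by lia) (by lia)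
      lia
    refine ⟨?_, hin⟩
    by_contra hcon
    exact hdeg r (r-1) (r+1) q (by lia) (by lia) (by lia) (by lia) (by lia)
      (by lia) (by lia) (k_dn (by lia) (by lia) (by lia) (by lia))
      (k_up (by lia) (by lia) (by lia)) (k_new (by lia))

set_option maxHeartbeats 4000000 in
lemma caseP {k r q f g : ℕ} (hk : 5 < k)
    (hr : r < k) (hq : k ≤ q) (hq2 : q < 2 * k)
    (hdeg : NoDeg3 (2 * k) (kadj k (k-1) 0 (k-1) (k+0) r q f g))
    (hcl : ClosedSz (2 * k) (k-1) (kadj k (k-1) 0 (k-1) (k+0) r q f g)) :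
    (r = 0 ∨ r = k - 1) ∧ (q = k ∨ q = 2 * k - 1) := by
  have hrq : ¬ (f = r ∧ g = q ∨ f = q ∧ g = r) := by
    intro h
    have := cl_use hcl 0 0 k (by lia) (by lia) (by lia)
        (by intro s h0 h1 h2 h3 h4; rcases h with h | h <;> lia) (by lia) (by lia)
    lia
  constructor
  · by_contra hcon
    have hff : (f = r ∧ g = r - 1 ∨ f = r - 1 ∧ g = r) ∨ 
        (f = r ∧ g = r + 1 ∨ f = r + 1 ∧ g = r) := by
      by_contra hcon
      exact hdeg r (r-1) (r+1) q (by lia) (by lia) (by lia) (by lia) (by lia)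
        (by lia) (by lia) (k_dn (by lia) (by lia) (by lia) (by lia))
        (k_up (by lia) (by lia) (by lia)) (k_new (by lia))
    rcases hff with h | h
    · have := cl_use hcl 0 0 r (by lia) (by lia) (by lia)
        (by intro s h0 h1 h2 h3 h4; rcases h with h | h <;> lia) (by lia) (by lia)
      lia
    · have := cl_use hcl 0 (r+1) k (by lia) (by lia) (by lia)
        (by intro s h0 h1 h2 h3 h4; rcases h with h | h <;> lia) (by lia) (by lia)
      lia
  · by_contra hcon
    have hff : (f = q ∧ g = q - 1 ∨ f = q - 1 ∧ g = q) ∨ 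
        (f = q ∧ g = q + 1 ∨ f = q + 1 ∧ g = q) := by
      by_contra hcon
      exact hdeg q (q-1) (q+1) r (by lia) (by lia) (by lia) (by lia) (by lia)
        (by lia) (by lia) (k_dn (by lia) (by lia) (by lia) (by lia))
        (k_up (by lia) (by lia) (by lia)) (k_symm (k_new (by lia)))
    rcases hff with h | h
    · have := cl_use hcl 0 k q (by lia) (by lia) (by lia)
        (by intro s h0 h1 h2 h3 h4; rcases h with h | h <;> lia) (by lia) (by lia)
      lia
    · have := cl_use hcl 0 (q+1) (2*k) (by lia) (by lia) (by lia)
        (by intro s h0 h1 h2 h3 h4; rcases h with h | h <;> lia) (by lia) (by lia)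
      lia

/-- having three neighbours -/
def Deg3 (n : ℕ) (A : ℕ → ℕ → Prop) (v : ℕ) : Prop :=
  ∃ a b c, a < n ∧ b < n ∧ c < n ∧ a ≠ b ∧ a ≠ c ∧ b ≠ c ∧ A v a ∧ A v b ∧ A v c

/-- a leaf is not close to a vertex of degree three -/
def LeafFar (n : ℕ) (A : ℕ → ℕ → Prop) : Prop :=
  (∀ l u, l < n → u < n → (∀ t, t < n → A l t → t = u) → Deg3 n A u → False) ∧
  (∀ l u w, l < n → u < n → w < n → (∀ t, t < n → A l t → t = u) →
    (∀ t, t < n → A u t → t = l ∨ t = w) → Deg3 n A w → False)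

/-- at most one vertex with three neighbours -/
def UniqDeg3 (n : ℕ) (A : ℕ → ℕ → Prop) : Prop :=
  ∀ v w, v < n → w < n → Deg3 n A v → Deg3 n A w → v = w

set_option maxHeartbeats 4000000 in
lemma caseA {x k r q f g : ℕ} (hx : 3 ≤ x) (hk : k = 2 * x + 1)
    (hr : r < x - 1) (hq : x - 1 ≤ q) (hq2 : q < 2 * k)
    (hleaf : LeafFar (2 * k) (kadj k x x (x-1-1) (x-1) r q f g))
    (hu : UniqDeg3 (2 * k) (kadj k x x (x-1-1) (x-1) r q f g))
    (hcl : ClosedSz (2 * k) x (kadj k x x (x-1-1) (x-1) r q f g)) :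
    (r = 0 ∨ r = x - 1 - 1) ∧ (q = x - 1) := by
  have huv : ¬ (f = x ∧ g = k + x ∨ f = k + x ∧ g = x) := by
    intro h
    by_cases hin : k ≤ q
    · have := cl_use hcl (x-1) k (2*k) (by lia) (by lia) (by lia)
        (by intro s h0 h1 h2 h3 h4; rcases h with h | h <;> lia) (by lia) (by lia)
      lia
    · have := cl_use hcl 0 k (2*k) (by lia) (by lia) (by lia)
        (by intro s h0 h1 h2 h3 h4; rcases h with h | h <;> lia) (by lia) (by lia)
      lia
  have hql : q = x - 1 := by
    by_contra hql
    have hlu : ¬ (f = x - 1 ∧ g = x ∨ f = x ∧ g = x - 1) := by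
      intro h
      have := cl_use hcl 0 (x-1) x (by lia) (by lia) (by lia)
        (by intro s h0 h1 h2 h3 h4; rcases h with h | h <;> lia) (by lia) (by lia)
      lia
    have hl : ∀ t, t < 2 * k → kadj k x x (x-1-1) (x-1) r q f g (x-1) t → t = x := by
      intro t ht h
      obtain ⟨h, -⟩ := h
      unfold cadj dadj pr at h
      lia
    have h3 := hleaf.1 (x-1) x (by lia) (by lia) hl
    by_cases hux : f = x ∧ g = x + 1 ∨ f = x + 1 ∧ g = x
    · by_cases hqu : q = x
      · subst hqu
        apply h3
        exact ⟨q-1, k+q, r, by lia, by lia, by lia, by lia, by lia, by lia,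
          k_dn (by lia) (by lia) (by lia) (by lia), k_cen (by lia) (by lia),
          k_symm (k_new (by lia))⟩
      · apply hleaf.2 (x-1) x (k+x) (by lia) (by lia) (by lia) hl
        · intro t ht h
          obtain ⟨h, h'⟩ := h
          unfold pr at h'
          unfold cadj dadj pr at h
          lia
        · exact ⟨x, k+x-1, k+x+1, by lia, by lia, by lia, by lia, by lia, by lia,
            k_symm (k_cen (by lia) (by lia)), k_dn (by lia) (by lia) (by lia) (by lia),
            k_up (by lia) (by lia) (by lia)⟩
    · apply h3
      exact ⟨x-1, x+1, k+x, by lia, by lia, by lia, by lia, by lia, by lia,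
        k_dn (by lia) (by lia) (by lia) (by lia), k_up (by lia) (by lia) (by lia),
        k_cen (by lia) (by lia)⟩
  refine ⟨?_, hql⟩
  by_contra hcon
  have hr3 : (f ≠ r ∧ g ≠ r) → Deg3 (2 * k) (kadj k x x (x-1-1) (x-1) r q f g) r := by
    intro h
    exact ⟨r-1, r+1, q, by lia, by lia, by lia, by lia, by lia, by lia,
      k_dn (by lia) (by lia) (by lia) (by lia), k_up (by lia) (by lia) (by lia),
      k_new (by lia)⟩
  have hu3 : ¬ (f = x - 1 ∧ g = x ∨ f = x ∧ g = x - 1) → ¬ (f = x ∧ g = x + 1 ∨ f = x + 1 ∧ g = x) →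
      Deg3 (2 * k) (kadj k x x (x-1-1) (x-1) r q f g) x := by
    intro h h'
    exact ⟨x-1, x+1, k+x, by lia, by lia, by lia, by lia, by lia, by lia,
        k_dn (by lia) (by lia) (by lia) (by lia), k_up (by lia) (by lia) (by lia),
        k_cen (by lia) (by lia)⟩
  have hv3 : (f ≠ k+x ∧ g ≠ k+x) → Deg3 (2 * k) (kadj k x x (x-1-1) (x-1) r q f g) (k+x) := by
    intro h
    exact ⟨x, k+x-1, k+x+1, by lia, by lia, by lia, by lia, by lia, by lia,
            k_symm (k_cen (by lia) (by lia)), k_dn (by lia) (by lia) (by lia) (by lia),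
            k_up (by lia) (by lia) (by lia)⟩
  have hv3' : Deg3 (2 * k) (kadj k x x (x-1-1) (x-1) r q f g) r →
      Deg3 (2 * k) (kadj k x x (x-1-1) (x-1) r q f g) x → False := by
    intro h1 h2
    have := hu r x (by lia) (by lia) h1 h2
    lia
  have hv3'' : Deg3 (2 * k) (kadj k x x (x-1-1) (x-1) r q f g) (k + x) →
      Deg3 (2 * k) (kadj k x x (x-1-1) (x-1) r q f g) x → False := by
    intro h1 h2
    have := hu (k+x) x (by lia) (by lia) h1 h2
    lia
  have hv3''' : Deg3 (2 * k) (kadj k x x (x-1-1) (x-1) r q f g) r →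
      Deg3 (2 * k) (kadj k x x (x-1-1) (x-1) r q f g) (k + x) → False := by
    intro h1 h2
    have := hu r (k+x) (by lia) (by lia) h1 h2
    lia
  by_cases ha : f = x - 1 ∧ g = x ∨ f = x ∧ g = x - 1
  · exact hv3''' (hr3 (by lia)) (hv3 (by lia))
  by_cases hb : f = x ∧ g = x + 1 ∨ f = x + 1 ∧ g = x
  · exact hv3''' (hr3 (by lia)) (hv3 (by lia))
  have hu4 := hu3 ha hb
  by_cases hc : f = k + x ∨ g = k + x
  · by_cases hd : f = r ∨ g = r
    · -- the edge joins r to the far branch vertex: both incident edges survive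
      exact hv3' ⟨r-1, r+1, q, by lia, by lia, by lia, by lia, by lia, by lia,
        k_dn (by lia) (by lia) (by lia) (by lia), k_up (by lia) (by lia) (by lia),
        k_new (by lia)⟩ hu4
    · exact hv3' (hr3 (by lia)) hu4
  · exact hv3'' (hv3 (by lia)) hu4


/-- two paths joined by an edge -/
def DG (k i j : ℕ) : SimpleGraph (Fin (2 * k)) where
  Adj a b := a ≠ b ∧ dadj k i j a b
  symm := ⟨by
    intro a b h
    refine ⟨h.1.symm, ?_⟩
    have := h.2
    simp only [dadj, pr] at *
    lia⟩
  loopless := ⟨fun a h => h.1 rfl⟩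

lemma DG_adj {k i j : ℕ} (hi : i < k) (a b : Fin (2 * k)) :
    (DG k i j).Adj a b ↔ dadj k i j a b := by
  constructor
  · exact fun h => h.2
  · intro h
    refine ⟨?_, h⟩
    rintro rfl
    simp only [dadj, pr] at h
    lia

lemma sym2_pr {n : ℕ} (a b c d : Fin n) : s(a, b) = s(c, d) ↔ pr a b c d := by
  simp only [Sym2.eq_iff, pr, Fin.ext_iff]

lemma DG_del_adj {k i j : ℕ} (hi : i < k) (a b c d : Fin (2 * k)) :
    ((DG k i j).deleteEdges {s(c, d)}).Adj a b ↔ cadj k i j c d a b := by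
  rw [SimpleGraph.deleteEdges_adj, DG_adj hi, Set.mem_singleton_iff, sym2_pr, cadj]

/-- the pair of edges `e`, `e'` determines `T` -/
def GoodPair {V : Type} (T : SimpleGraph V) (e e' : Sym2 V) : Prop :=
  ∀ (W : Type) (_ : Fintype W) (H : SimpleGraph W) (f1 f2 : Sym2 W),
    f1 ∈ H.edgeSet → f2 ∈ H.edgeSet →
    Nonempty (H.deleteEdges {f1} ≃g T.deleteEdges {e}) →
    Nonempty (H.deleteEdges {f2} ≃g T.deleteEdges {e'}) → Nonempty (H ≃g T)

/-- two edges suffice -/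
def Good {V : Type} (T : SimpleGraph V) : Prop :=
  ∃ e e', e ≠ e' ∧ e ∈ T.edgeSet ∧ e' ∈ T.edgeSet ∧ GoodPair T e e'

lemma adj_iff_del {V : Type} (T : SimpleGraph V) (e : Sym2 V) (he : e ∈ T.edgeSet) (a b : V) :
    T.Adj a b ↔ (T.deleteEdges {e}).Adj a b ∨ s(a, b) = e := by
  rw [SimpleGraph.deleteEdges_adj, Set.mem_singleton_iff]
  constructor
  · intro h
    by_cases h' : s(a, b) = e
    · exact Or.inr h'
    · exact Or.inl ⟨h, h'⟩
  · rintro (h | rfl)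
    · exact h.1
    · exact he

lemma core {V : Type} (T : SimpleGraph V) (e e' : Sym2 V) (he : e ∈ T.edgeSet)
    (h : ∀ (r q f g : V) (K : SimpleGraph V), r ≠ q →
      (∀ a b, K.Adj a b ↔ ((T.deleteEdges {e}).Adj a b ∨ s(a, b) = s(r, q)) ∧ ¬ s(a, b) = s(f, g)) →
      Nonempty (K ≃g T.deleteEdges {e'}) →
      ∃ σ : T.deleteEdges {e} ≃g T.deleteEdges {e}, s(σ r, σ q) = e) :
    GoodPair T e e' := by
  rintro W _ H f1 f2 hf1 hf2 ⟨φ⟩ ⟨ψ⟩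
  induction f1 using Sym2.ind with
  | _ x y =>
  induction f2 using Sym2.ind with
  | _ x2 y2 =>
  have hinj : ∀ (a b : V) (c d : W), s(φ.symm a, φ.symm b) = s(c, d) ↔ s(a, b) = s(φ c, φ d) := by
    intro a b c d
    rw [← (Sym2.map.injective φ.injective).eq_iff]
    simp
  obtain ⟨σ, hσ⟩ := h (φ x) (φ y) (φ x2) (φ y2) ((H.deleteEdges {s(x2, y2)}).comap φ.symm)
    (by
      intro h
      exact (H.ne_of_adj hf1) (φ.injective h))
    (by
      intro a b
      rw [SimpleGraph.comap_adj, SimpleGraph.deleteEdges_adj, Set.mem_singleton_iff,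
        adj_iff_del H _ hf1, hinj, hinj]
      rw [φ.symm.map_adj_iff])
    ⟨(SimpleGraph.Iso.comap φ.symm.toEquiv _).trans ψ⟩
  refine ⟨⟨φ.toEquiv.trans σ.toEquiv, ?_⟩⟩
  intro a b
  rw [adj_iff_del H _ hf1, adj_iff_del T e he]
  have h1 : (T.deleteEdges {e}).Adj ((φ.toEquiv.trans σ.toEquiv) a) ((φ.toEquiv.trans σ.toEquiv) b)
    ↔ (H.deleteEdges {s(x, y)}).Adj a b := by
    exact (σ.map_adj_iff (v := φ a) (w := φ b)).trans φ.map_adj_iff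
  have h2 : s((φ.toEquiv.trans σ.toEquiv) a, (φ.toEquiv.trans σ.toEquiv) b) = s(σ (φ x), σ (φ y)) ↔
      s(a, b) = s(x, y) := by
    have := (Sym2.map.injective (φ.toEquiv.trans σ.toEquiv).injective).eq_iff (a := s(a, b)) (b := s(x, y))
    rw [← this]
    rfl
  rw [hσ] at h2
  rw [h1, h2]

lemma Good.congr {V V' : Type} {T : SimpleGraph V} {T' : SimpleGraph V'} (ι : T ≃g T')
    (h : Good T) : Good T' := by
  obtain ⟨e, e', hne, he, he', hp⟩ := h
  have hdel : ∀ e, Nonempty (T'.deleteEdges {e.map ι} ≃g T.deleteEdges {e}) := by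
    intro e
    refine ⟨SimpleGraph.Iso.symm ⟨ι.toEquiv, ?_⟩⟩
    intro a b
    rw [SimpleGraph.deleteEdges_adj, SimpleGraph.deleteEdges_adj, Set.mem_singleton_iff,
      Set.mem_singleton_iff]
    have h1 := (Sym2.map.injective ι.injective).eq_iff (a := s(a, b)) (b := e)
    have h2 : T'.Adj (ι.toEquiv a) (ι.toEquiv b) ↔ T.Adj a b := ι.map_adj_iff
    rw [h2, ← h1]
    rfl
  have hed : ∀ e ∈ T.edgeSet, e.map ι ∈ T'.edgeSet := by
    intro e he
    induction e using Sym2.ind with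
    | _ x y => exact ι.map_adj_iff.2 he
  refine ⟨e.map ι, e'.map ι, fun h => hne (Sym2.map.injective ι.injective h), hed _ he, hed _ he', ?_⟩
  rintro W _ H f1 f2 hf1 hf2 ⟨φ⟩ ⟨ψ⟩
  obtain ⟨d1⟩ := hdel e
  obtain ⟨d2⟩ := hdel e'
  obtain ⟨χ⟩ := hp W inferInstance H f1 f2 hf1 hf2 ⟨φ.trans d1⟩ ⟨ψ.trans d2⟩
  exact ⟨χ.trans ι⟩

lemma ern_le_of_good {V : Type} [Fintype V] {T : SimpleGraph V} (h : Good T) :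
    2 ∈ {k | ∃ s : Finset (Sym2 V), s.card = k ∧ (↑s : Set (Sym2 V)) ⊆ T.edgeSet ∧
    ∀ (W : Type) (_ : Fintype W) (H : SimpleGraph W) (t : Finset (Sym2 W)),
      (↑t : Set (Sym2 W)) ⊆ H.edgeSet →
      (∃ φ : {e // e ∈ s} ≃ {f // f ∈ t},
        ∀ e : {e // e ∈ s},
          Nonempty (H.deleteEdges {(φ e).1} ≃g T.deleteEdges {e.1})) →
      Nonempty (H ≃g T)} := by
  classical
  obtain ⟨e, e', hne, he, he', hp⟩ := h
  refine ⟨{e, e'}, Finset.card_pair hne, ?_, ?_⟩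
  · intro x hx
    simp only [Finset.coe_insert, Finset.coe_singleton, Set.mem_insert_iff, Set.mem_singleton_iff] at hx
    rcases hx with rfl | rfl <;> assumption
  · rintro W _ H t ht ⟨φ, hφ⟩
    exact hp W inferInstance H (φ ⟨e, by simp⟩).1 (φ ⟨e', by simp⟩).1 (ht (φ _).2) (ht (φ _).2)
      (hφ ⟨e, by simp⟩) (hφ ⟨e', by simp⟩)

section transfer
variable {n : ℕ} {G G' : SimpleGraph (Fin n)} {A A' : ℕ → ℕ → Prop}

lemma deg3_transfer (hG : ∀ a b : Fin n, G.Adj a b ↔ A a b)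
    (hG' : ∀ a b : Fin n, G'.Adj a b ↔ A' a b) (φ : G ≃g G') (v : Fin n) (h : Deg3 n A v) :
    Deg3 n A' (φ v) := by
  obtain ⟨a, b, c, ha, hb, hc, hab, hac, hbc, h1, h2, h3⟩ := h
  have hne : ∀ a b (ha : a < n) (hb : b < n), a ≠ b →
      ((φ ⟨a, ha⟩ : Fin n) : ℕ) ≠ (φ ⟨b, hb⟩ : Fin n) := by
    intro a b ha hb hab h
    have := φ.injective (Fin.ext h)
    rw [Fin.mk.injEq] at this
    exact hab this
  have hadj : ∀ a (ha : a < n), A v a → A' (φ v) (φ ⟨a, ha⟩) := by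
    intro a ha h
    rw [← hG', φ.map_adj_iff, hG]
    exact h
  exact ⟨φ ⟨a, ha⟩, φ ⟨b, hb⟩, φ ⟨c, hc⟩, Fin.is_lt _, Fin.is_lt _, Fin.is_lt _,
    hne _ _ _ _ hab, hne _ _ _ _ hac, hne _ _ _ _ hbc, hadj _ _ h1, hadj _ _ h2, hadj _ _ h3⟩

lemma noDeg3_transfer (hG : ∀ a b : Fin n, G.Adj a b ↔ A a b)
    (hG' : ∀ a b : Fin n, G'.Adj a b ↔ A' a b) (φ : G ≃g G') (h : NoDeg3 n A') : NoDeg3 n A := by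
  intro v a b c hv ha hb hc hab hac hbc h1 h2 h3
  obtain ⟨a, b, c, ha, hb, hc, hab, hac, hbc, h1, h2, h3⟩ :=
    deg3_transfer hG hG' φ ⟨v, hv⟩ ⟨a, b, c, ha, hb, hc, hab, hac, hbc, h1, h2, h3⟩
  exact h _ a b c (Fin.is_lt _) ha hb hc hab hac hbc h1 h2 h3

lemma uniqDeg3_transfer (hG : ∀ a b : Fin n, G.Adj a b ↔ A a b)
    (hG' : ∀ a b : Fin n, G'.Adj a b ↔ A' a b) (φ : G ≃g G') (h : UniqDeg3 n A') :
    UniqDeg3 n A := by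
  intro v w hv hw h1 h2
  have := h _ _ (Fin.is_lt _) (Fin.is_lt _) (deg3_transfer hG hG' φ ⟨v, hv⟩ h1)
    (deg3_transfer hG hG' φ ⟨w, hw⟩ h2)
  have := φ.injective (Fin.ext this)
  rwa [Fin.mk.injEq] at this

lemma leafFar_transfer (hG : ∀ a b : Fin n, G.Adj a b ↔ A a b)
    (hG' : ∀ a b : Fin n, G'.Adj a b ↔ A' a b) (φ : G ≃g G') (h : LeafFar n A') :
    LeafFar n A := by
  have key : ∀ l (hl : l < n) t (ht : t < n), A' (φ ⟨l, hl⟩) t → A l (φ.symm ⟨t, ht⟩) := by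
    intro l hl t ht h
    rw [← hG ⟨l, hl⟩, ← φ.map_adj_iff, hG', φ.apply_symm_apply]
    exact h
  have key2 : ∀ u (hu : u < n) t (ht : t < n), ((φ.symm ⟨t, ht⟩ : Fin n) : ℕ) = u →
      t = (φ ⟨u, hu⟩ : Fin n) := by
    rintro u hu t ht rfl
    simp
  constructor
  · intro l u hl hu h1 h2
    refine h.1 (φ ⟨l, hl⟩ : Fin n) _ (Fin.is_lt _) (Fin.is_lt _) ?_
      (deg3_transfer hG hG' φ ⟨u, hu⟩ h2)
    · intro t ht h3
      exact key2 _ _ _ ht (h1 _ (Fin.is_lt _) (key l hl t ht h3))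
  · intro l u w hl hu hw h1 h1' h2
    refine h.2 (φ ⟨l, hl⟩ : Fin n) (φ ⟨u, hu⟩ : Fin n) _ (Fin.is_lt _) (Fin.is_lt _) (Fin.is_lt _)
      ?_ ?_ (deg3_transfer hG hG' φ ⟨w, hw⟩ h2)
    · intro t ht h3
      exact key2 _ _ _ ht (h1 _ (Fin.is_lt _) (key l hl t ht h3))
    · intro t ht h3
      rcases h1' _ (Fin.is_lt _) (key u hu t ht h3) with h4 | h4
      · exact Or.inl (key2 _ _ _ ht h4)
      · exact Or.inr (key2 _ _ _ ht h4)

/-- possible sizes of sets closed under adjacency -/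
def AllClosed (n p : ℕ) (A : ℕ → ℕ → Prop) : Prop :=
  ∀ S : Finset (Fin n), (∀ s t : Fin n, A s t → s ∈ S → t ∈ S) →
    S.card = 0 ∨ S.card = p ∨ S.card = n - p ∨ S.card = n

lemma card_interval {n m a b : ℕ} (hm : m ≤ a) (hab : a ≤ b) (hb : b ≤ n) :
    (Finset.univ.filter (fun s : Fin n => (s : ℕ) < m ∨ (a ≤ (s : ℕ) ∧ (s : ℕ) < b))).card
      = m + (b - a) := by
  have h1 : (Finset.univ.filter (fun s : Fin n => (s : ℕ) < m ∨ (a ≤ (s : ℕ) ∧ (s : ℕ) < b))).map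
      Fin.valEmbedding = Finset.range m ∪ Finset.Ico a b := by
    ext x
    simp only [Finset.mem_map, Finset.mem_filter, Finset.mem_univ, true_and, Fin.valEmbedding_apply,
      Finset.mem_union, Finset.mem_range, Finset.mem_Ico]
    constructor
    · rintro ⟨y, hy, rfl⟩
      exact hy
    · intro h
      exact ⟨⟨x, by lia⟩, h, rfl⟩
  rw [← Finset.card_map Fin.valEmbedding, h1, Finset.card_union_of_disjoint, Finset.card_range,
    Nat.card_Ico]
  rw [Finset.disjoint_left]
  intro x hx hy
  rw [Finset.mem_range] at hx
  rw [Finset.mem_Ico] at hy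
  lia

lemma closed_transfer {p : ℕ} (hG : ∀ a b : Fin n, G.Adj a b ↔ A a b)
    (hG' : ∀ a b : Fin n, G'.Adj a b ↔ A' a b) (φ : G ≃g G') (h : AllClosed n p A') :
    ClosedSz n p A := by
  intro m a b hm hab hb hcl
  have := h ((Finset.univ.filter
    (fun s : Fin n => (s : ℕ) < m ∨ (a ≤ (s : ℕ) ∧ (s : ℕ) < b))).map φ.toEquiv.toEmbedding) (by
      intro s t hst hs
      rw [Finset.mem_map_equiv, Finset.mem_filter] at *
      refine ⟨Finset.mem_univ _, hcl _ _ (Fin.is_lt _) (Fin.is_lt _) ?_ hs.2⟩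
      rw [← hG, ← φ.map_adj_iff, hG']
      have e1 : ∀ s, φ (φ.toEquiv.symm s) = s := fun s => φ.toEquiv.apply_symm_apply s
      rw [e1, e1]
      exact hst)
  rwa [Finset.card_map, card_interval hm hab hb] at this

end transfer

/-- a set closed under adjacency that contains all or nothing of an interval and its complement -/
lemma allClosed_of {n p : ℕ} (hp : p ≤ n) {A : ℕ → ℕ → Prop}
    (h : ∀ P : ℕ → Prop, (∀ s t, s < n → t < n → A s t → (P s → P t)) →
      (∀ s t, s < p → t < p → (P s → P t)) ∧ 
      (∀ s t, p ≤ s → p ≤ t → s < n → t < n → (P s → P t))) : AllClosed n p A := by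
  intro S hS
  obtain ⟨h1, h2⟩ := h (fun s => ∃ hs : s < n, (⟨s, hs⟩ : Fin n) ∈ S) (by
    rintro s t hs ht hst ⟨_, h⟩
    exact ⟨ht, hS ⟨s, hs⟩ ⟨t, ht⟩ hst h⟩)
  have h1' : ∀ s t : Fin n, (s : ℕ) < p → (t : ℕ) < p → s ∈ S → t ∈ S := by
    intro s t hs ht h
    exact (h1 s t hs ht ⟨s.2, h⟩).2
  have h2' : ∀ s t : Fin n, p ≤ (s : ℕ) → p ≤ (t : ℕ) → s ∈ S → t ∈ S := by
    intro s t hs ht h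
    exact (h2 s t hs ht s.2 t.2 ⟨s.2, h⟩).2
  by_cases ha : ∃ s : Fin n, (s : ℕ) < p ∧ s ∈ S
  · obtain ⟨s, hs, hsS⟩ := ha
    by_cases hb : ∃ t : Fin n, p ≤ (t : ℕ) ∧ t ∈ S
    · obtain ⟨t, ht, htS⟩ := hb
      have : S = Finset.univ := by
        ext x
        simp only [Finset.mem_univ, iff_true]
        by_cases hx : (x : ℕ) < p
        · exact h1' s x hs hx hsS
        · exact h2' t x ht (by lia) htS
      rw [this]
      simp
    · have : S = Finset.univ.filter (fun s : Fin n => (s : ℕ) < p ∨ (p ≤ (s : ℕ) ∧ (s : ℕ) < p)) := by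
        ext x
        simp only [Finset.mem_filter, Finset.mem_univ, true_and]
        constructor
        · intro hx
          left
          by_contra hc
          exact hb ⟨x, by lia, hx⟩
        · intro hx
          exact h1' s x hs (by lia) hsS
      rw [this, card_interval le_rfl le_rfl hp]
      lia
  · by_cases hb : ∃ t : Fin n, p ≤ (t : ℕ) ∧ t ∈ S
    · obtain ⟨t, ht, htS⟩ := hb
      have : S = Finset.univ.filter (fun s : Fin n => (s : ℕ) < 0 ∨ (p ≤ (s : ℕ) ∧ (s : ℕ) < n)) := by
        ext x
        simp only [Finset.mem_filter, Finset.mem_univ, true_and]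
        constructor
        · intro hx
          have := x.2
          by_contra hc
          exact ha ⟨x, by lia, hx⟩
        · intro hx
          exact h2' t x ht (by lia) htS
      rw [this, card_interval (by lia) hp le_rfl]
      lia
    · left
      rw [Finset.card_eq_zero, Finset.eq_empty_iff_forall_notMem]
      intro x hx
      by_cases hx' : (x : ℕ) < p
      · exact ha ⟨x, hx', hx⟩
      · exact hb ⟨x, by lia, hx⟩

/-- propagation along an interval -/
lemma interval_prop {P : ℕ → Prop} {a b : ℕ}
    (h : ∀ s, a ≤ s → s + 1 < b → (P s ↔ P (s+1))) (s t : ℕ) (hs : a ≤ s) (hs' : s < b)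
    (ht : a ≤ t) (ht' : t < b) : P s ↔ P t := by
  have key : ∀ d, a + d < b → (P a ↔ P (a + d)) := by
    intro d
    induction d with
    | zero => intro _; rfl
    | succ d ih =>
      intro hd
      exact (ih (by lia)).trans (h (a + d) (by lia) (by lia))
  have h1 := key (s - a) (by lia)
  have h2 := key (t - a) (by lia)
  rw [show a + (s - a) = s by lia] at h1
  rw [show a + (t - a) = t by lia] at h2
  exact h1.symm.trans h2

lemma cadj_symm {k i j c d a b : ℕ} (h : cadj k i j c d a b) : cadj k i j c d b a := by
  simp only [cadj, dadj, pr] at *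
  lia

lemma allClosed_cen {k i j : ℕ} (hi : i < k) :
    AllClosed (2 * k) k (cadj k i j i (k + j)) := by
  apply allClosed_of (by lia)
  intro P hP
  have hst : ∀ s, s + 1 < 2 * k → s + 1 ≠ k → (P s ↔ P (s+1)) := by
    intro s h1 h2
    have h3 : cadj k i j i (k + j) s (s+1) := by
      simp only [cadj, dadj, pr]; lia
    exact ⟨hP s (s+1) (by lia) h1 h3, hP (s+1) s h1 (by lia) (cadj_symm h3)⟩
  constructor
  · intro s t hs ht
    exact (interval_prop (a := 0) (b := k) (fun s h1 h2 => hst s (by lia) (by lia)) s t (by lia)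
      (by lia) (by lia) (by lia)).1
  · intro s t hs ht hs' ht'
    exact (interval_prop (a := k) (b := 2 * k) (fun s h1 h2 => hst s (by lia) (by lia)) s t (by lia)
      (by lia) (by lia) (by lia)).1

lemma allClosed_cut {k i j p : ℕ} (hi : i < k) (hj : j < k) (hp : 0 < p) (hpi : p ≤ i) :
    AllClosed (2 * k) p (cadj k i j (p - 1) p) := by
  apply allClosed_of (by lia)
  intro P hP
  have hst : ∀ s, s + 1 < 2 * k → s + 1 ≠ k → s + 1 ≠ p → (P s ↔ P (s+1)) := by
    intro s h1 h2 h4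
    have h3 : cadj k i j (p - 1) p s (s+1) := by
      simp only [cadj, dadj, pr]; lia
    exact ⟨hP s (s+1) (by lia) h1 h3, hP (s+1) s h1 (by lia) (cadj_symm h3)⟩
  have hc : P i ↔ P (k + j) := by
    have h3 : cadj k i j (p - 1) p i (k + j) := by
      simp only [cadj, dadj, pr]; lia
    exact ⟨hP _ _ (by lia) (by lia) h3, hP _ _ (by lia) (by lia) (cadj_symm h3)⟩
  constructor
  · intro s t hs ht
    exact (interval_prop (a := 0) (b := p) (fun s h1 h2 => hst s (by lia) (by lia) (by lia)) s t
      (by lia) (by lia) (by lia) (by lia)).1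
  · have hall : ∀ s, p ≤ s → s < 2 * k → (P s ↔ P i) := by
      intro s hs hs'
      by_cases hsk : s < k
      · exact interval_prop (a := p) (b := k) (fun s h1 h2 => hst s (by lia) (by lia) (by lia)) s i
          (by lia) (by lia) (by lia) (by lia)
      · exact (interval_prop (a := k) (b := 2 * k) (fun s h1 h2 => hst s (by lia) (by lia) (by lia))
          s (k + j) (by lia) (by lia) (by lia) (by lia)).trans hc.symm
    intro s t hs ht hs' ht' h
    exact (hall t ht ht').2 ((hall s hs hs').1 h)

lemma noDeg3_cen {k i j : ℕ} :
    NoDeg3 (2 * k) (cadj k i j i (k + j)) := by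
  intro v a b c hv ha hb hc hab hac hbc h1 h2 h3
  simp only [cadj, dadj, pr] at h1 h2 h3
  lia

lemma noDeg3_cut {k : ℕ} (hk : 5 < k) :
    NoDeg3 (2 * k) (cadj k (k-1) 0 (k - 1 - 1) (k-1)) := by
  intro v a b c hv ha hb hc hab hac hbc h1 h2 h3
  simp only [cadj, dadj, pr] at h1 h2 h3
  lia

lemma deg3_cut {x k v : ℕ} (hx : 3 ≤ x) (hk : k = 2 * x + 1)
    (h : Deg3 (2 * k) (cadj k x x (x - 1) x) v) : v = k + x := by
  obtain ⟨a, b, c, ha, hb, hc, hab, hac, hbc, h1, h2, h3⟩ := h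
  simp only [cadj, dadj, pr] at h1 h2 h3
  lia

lemma uniqDeg3_cut {x k : ℕ} (hx : 3 ≤ x) (hk : k = 2 * x + 1) :
    UniqDeg3 (2 * k) (cadj k x x (x - 1) x) := by
  intro v w _ _ hv hw
  rw [deg3_cut hx hk hv, deg3_cut hx hk hw]

lemma cut_nbrs {x k l : ℕ} {Q : ℕ → Prop} (hx : 3 ≤ x) (hk : k = 2 * x + 1)
    (h : ∀ t, t < 2 * k → cadj k x x (x - 1) x l t → Q t) (hl : l < 2 * k) :
    (l + 1 < 2 * k → l + 1 ≠ k → l + 1 ≠ x → Q (l + 1)) ∧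
    (0 < l → l ≠ k → l ≠ x → Q (l - 1)) ∧ (l = x → Q (k + x)) ∧ (l = k + x → Q x) := by
  refine ⟨fun h1 h2 h3 => h _ h1 ?_, fun h1 h2 h3 => h _ (by lia) ?_, fun h1 => h _ (by lia) ?_,
    fun h1 => h _ (by lia) ?_⟩
  all_goals
    unfold cadj dadj pr
    lia

lemma leafFar_cut {x k : ℕ} (hx : 3 ≤ x) (hk : k = 2 * x + 1) :
    LeafFar (2 * k) (cadj k x x (x - 1) x) := by
  constructor
  · intro l u hl hu h1 h2
    have := deg3_cut hx hk h2
    have h3 := cut_nbrs hx hk h1 hl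
    clear h1 h2
    lia
  · intro l u w hl hu hw h1 h1' h2
    have := deg3_cut hx hk h2
    have h3 := cut_nbrs hx hk h1 hl
    have h4 := cut_nbrs hx hk h1' hu
    clear h1 h2 h1'
    lia

/-- reflection of the interval `[a, b)` -/
def reflIv (a b t : ℕ) : ℕ := if a ≤ t ∧ t < b then a + b - 1 - t else t

lemma mkIso {n : ℕ} {G G' : SimpleGraph (Fin n)} {A A' : ℕ → ℕ → Prop}
    (hG : ∀ a b : Fin n, G.Adj a b ↔ A a b) (hG' : ∀ a b : Fin n, G'.Adj a b ↔ A' a b)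
    (ρ : ℕ → ℕ) (h1 : ∀ t, t < n → ρ t < n) (h2 : ∀ t, t < n → ρ (ρ t) = t)
    (h3 : ∀ s t, s < n → t < n → A s t → A' (ρ s) (ρ t))
    (h4 : ∀ s t, s < n → t < n → A' s t → A (ρ s) (ρ t)) :
    ∃ σ : G ≃g G', ∀ t : Fin n, (σ t : ℕ) = ρ t := by
  let e : Fin n ≃ Fin n :=
    { toFun := fun t => ⟨ρ t, h1 t t.2⟩
      invFun := fun t => ⟨ρ t, h1 t t.2⟩
      left_inv := fun t => Fin.ext (h2 t t.2)
      right_inv := fun t => Fin.ext (h2 t t.2) }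
  refine ⟨⟨e, ?_⟩, fun t => rfl⟩
  intro a b
  rw [hG, hG']
  constructor
  · intro h
    have := h4 _ _ (h1 a a.2) (h1 b b.2) h
    rwa [h2 _ a.2, h2 _ b.2] at this
  · intro h
    exact h3 _ _ a.2 b.2 h

lemma aut_refl {n : ℕ} {G : SimpleGraph (Fin n)} {A : ℕ → ℕ → Prop}
    (hG : ∀ a b : Fin n, G.Adj a b ↔ A a b) (a b : ℕ) (hb : b ≤ n)
    (h : ∀ s t, s < n → t < n → A s t → A (reflIv a b s) (reflIv a b t)) :
    ∃ σ : G ≃g G, ∀ t : Fin n, (σ t : ℕ) = reflIv a b t := by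
  apply mkIso hG hG (reflIv a b) ?_ ?_ h h
  · intro t ht
    unfold reflIv
    split_ifs <;> lia
  · intro t ht
    unfold reflIv
    split_ifs <;> lia

/-- an automorphism fixing everything outside `[a, b)` and moving one end to the other -/
lemma aut_end {n : ℕ} {G : SimpleGraph (Fin n)} {A : ℕ → ℕ → Prop}
    (hG : ∀ a b : Fin n, G.Adj a b ↔ A a b) (a b x y : ℕ) (hb : b ≤ n) (hab : a < b)
    (h : ∀ s t, s < n → t < n → A s t → A (reflIv a b s) (reflIv a b t))
    (hx : x = a ∨ x = b - 1) (hy : y = a ∨ y = b - 1) :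
    ∃ σ : G ≃g G, (∀ t : Fin n, ((t : ℕ) < a ∨ b ≤ (t : ℕ)) → σ t = t) ∧
      ∀ t : Fin n, (t : ℕ) = x → (σ t : ℕ) = y := by
  by_cases hxy : x = y
  · refine ⟨SimpleGraph.Iso.refl, fun t _ => rfl, ?_⟩
    intro t ht
    exact ht.trans hxy
  · obtain ⟨σ, hσ⟩ := aut_refl hG a b hb h
    refine ⟨σ, ?_, ?_⟩
    · intro t ht
      apply Fin.ext
      rw [hσ]
      unfold reflIv
      split_ifs <;> lia
    · intro t ht
      rw [hσ]
      unfold reflIv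
      split_ifs <;> lia

lemma cadj_refl_low {k i j m : ℕ} (hi : i < k) (hm : 0 < m) (hmi : m ≤ i) (s t : ℕ)
    (h : cadj k i j (m - 1) m s t) :
    cadj k i j (m - 1) m (reflIv 0 m s) (reflIv 0 m t) := by
  unfold cadj dadj pr at *
  unfold reflIv
  split_ifs <;> lia

lemma cadj_refl_mid {k i j m : ℕ} (hi : i < k) (hm : 0 < m) (hmi : m + (k - 1) = 2 * i) (s t : ℕ)
    (h : cadj k i j (m - 1) m s t) :
    cadj k i j (m - 1) m (reflIv m k s) (reflIv m k t) := by
  unfold cadj dadj pr at *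
  unfold reflIv
  split_ifs <;> lia

lemma cadj_refl_left {k i j : ℕ} (hi : i < k) (s t : ℕ)
    (h : cadj k i j i (k + j) s t) :
    cadj k i j i (k + j) (reflIv 0 k s) (reflIv 0 k t) := by
  unfold cadj dadj pr at *
  unfold reflIv
  split_ifs <;> lia

lemma cadj_refl_right {k i j : ℕ} (hi : i < k) (hj : j < k) (s t : ℕ) (hs : s < 2 * k)
    (ht : t < 2 * k)
    (h : cadj k i j i (k + j) s t) :
    cadj k i j i (k + j) (reflIv k (2 * k) s) (reflIv k (2 * k) t) := by
  unfold cadj dadj pr at *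
  unfold reflIv
  split_ifs <;> lia

lemma good_of {k i j c d c' d' : ℕ} (hi : i < k) (hc : c < 2 * k) (hd : d < 2 * k)
    (hc' : c' < 2 * k) (hd' : d' < 2 * k) (h1 : dadj k i j c d) (h2 : dadj k i j c' d')
    (hne : ¬ pr c d c' d')
    (h : ∀ r q f g : Fin (2 * k), ∀ K : SimpleGraph (Fin (2 * k)),
      (∀ a b : Fin (2 * k), K.Adj a b ↔ kadj k i j c d r q f g a b) →
      (∀ a b : Fin (2 * k), ((DG k i j).deleteEdges {s(⟨c, hc⟩, ⟨d, hd⟩)}).Adj a b ↔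
        cadj k i j c d a b) →
      (∀ a b : Fin (2 * k), ((DG k i j).deleteEdges {s(⟨c', hc'⟩, ⟨d', hd'⟩)}).Adj a b ↔
        cadj k i j c' d' a b) →
      (K ≃g (DG k i j).deleteEdges {s(⟨c', hc'⟩, ⟨d', hd'⟩)}) →
      ∃ σ : (DG k i j).deleteEdges {s(⟨c, hc⟩, ⟨d, hd⟩)} ≃g
        (DG k i j).deleteEdges {s(⟨c, hc⟩, ⟨d, hd⟩)}, pr (σ r) (σ q) c d) :
    Good (DG k i j) := by
  refine ⟨s(⟨c, hc⟩, ⟨d, hd⟩), s(⟨c', hc'⟩, ⟨d', hd'⟩), ?_, (DG_adj hi _ _).2 h1,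
    (DG_adj hi _ _).2 h2, ?_⟩
  · intro h
    rw [sym2_pr] at h
    exact hne h
  · apply core _ _ _ ((DG_adj hi _ _).2 h1)
    rintro r q f g K hrq hK ⟨ψ⟩
    obtain ⟨σ, hσ⟩ := h r q f g K
      (fun a b => by rw [hK, DG_del_adj hi, sym2_pr, sym2_pr]; rfl)
      (fun a b => DG_del_adj hi a b ⟨c, hc⟩ ⟨d, hd⟩)
      (fun a b => DG_del_adj hi a b ⟨c', hc'⟩ ⟨d', hd'⟩) ψ
    refine ⟨σ, ?_⟩
    rw [sym2_pr]
    exact hσ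

lemma kadj_comm {k i j c d r q f g : ℕ} :
    kadj k i j c d r q f g = kadj k i j c d q r f g := by
  funext a b
  unfold kadj pr
  apply propext
  tauto

lemma good_B {k i j m : ℕ} (hk : 5 < k) (hm : 0 < m) (hi : i + 1 < k) (hj : j < k)
    (hmi : m + (k - 1) = 2 * i) : Good (DG k i j) := by
  apply good_of (c := m - 1) (d := m) (c' := i) (d' := k + j) (by lia) (by lia) (by lia)
    (by lia) (by lia) (by unfold dadj pr; lia) (by unfold dadj pr; lia) (by unfold pr; lia)
  intro r q f g K hK h1 h2 ψ
  have key : ∀ r q : Fin (2 * k), (r : ℕ) < m → m ≤ (q : ℕ) →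
      (∀ a b : Fin (2 * k), K.Adj a b ↔ kadj k i j (m - 1) m r q f g a b) →
      ∃ σ : (DG k i j).deleteEdges {s(⟨m - 1, by lia⟩, ⟨m, by lia⟩)} ≃g
        (DG k i j).deleteEdges {s(⟨m - 1, by lia⟩, ⟨m, by lia⟩)}, (σ r : ℕ) = m - 1 ∧ (σ q : ℕ) = m := by
    intro r q hr hq hK
    obtain ⟨hr', hq'⟩ := caseB hm hi hj hmi hr hq q.2 (noDeg3_transfer hK h2 ψ noDeg3_cen)
      (closed_transfer hK h2 ψ (allClosed_cen (by lia)))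
    obtain ⟨σ, hσ, hσ'⟩ := aut_end h1 0 m r (m - 1) (by lia) hm
      (fun s t _ _ => cadj_refl_low (by lia) hm (by lia) s t) hr' (Or.inr rfl)
    obtain ⟨τ, hτ, hτ'⟩ := aut_end h1 m k q m (by lia) (by lia)
      (fun s t _ _ => cadj_refl_mid (by lia) hm hmi s t) hq' (Or.inl rfl)
    refine ⟨σ.trans τ, ?_, ?_⟩
    · change (τ (σ r) : ℕ) = _
      rw [hτ _ (by rw [hσ' r rfl]; lia), hσ' r rfl]
    · change (τ (σ q) : ℕ) = _
      rw [hσ q (by lia), hτ' q rfl]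
  rcases sep (m := m) (p := k) hm (by lia) (by lia) le_rfl (by lia) (by lia) (by lia)
    (closed_transfer hK h2 ψ (allClosed_cen (by lia))) with h | h
  · obtain ⟨σ, hσ⟩ := key r q h.1 h.2 hK
    exact ⟨σ, Or.inl hσ⟩
  · obtain ⟨σ, hσ⟩ := key q r h.1 h.2 (by rw [kadj_comm]; exact hK)
    exact ⟨σ, Or.inr hσ.symm⟩

lemma good_I {k j : ℕ} (hk : 5 < k) (hj : 2 * j + 1 = k) : Good (DG k (k - 1) j) := by
  apply good_of (c := k - 1 - 1) (d := k - 1) (c' := k - 1) (d' := k + j) (by lia) (by lia) (by lia)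
    (by lia) (by lia) (by unfold dadj pr; lia) (by unfold dadj pr; lia) (by unfold pr; lia)
  intro r q f g K hK h1 h2 ψ
  have key : ∀ r q : Fin (2 * k), (r : ℕ) < k - 1 → k - 1 ≤ (q : ℕ) →
      (∀ a b : Fin (2 * k), K.Adj a b ↔ kadj k (k - 1) j (k - 1 - 1) (k - 1) r q f g a b) →
      ∃ σ : (DG k (k - 1) j).deleteEdges {s(⟨k - 1 - 1, by lia⟩, ⟨k - 1, by lia⟩)} ≃g
        (DG k (k - 1) j).deleteEdges {s(⟨k - 1 - 1, by lia⟩, ⟨k - 1, by lia⟩)},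
          (σ r : ℕ) = k - 1 - 1 ∧ (σ q : ℕ) = k - 1 := by
    intro r q hr hq hK
    obtain ⟨hr', hq'⟩ := caseI hk hj hr hq q.2 (noDeg3_transfer hK h2 ψ noDeg3_cen)
      (closed_transfer hK h2 ψ (allClosed_cen (by lia)))
    obtain ⟨σ, hσ, hσ'⟩ := aut_end h1 0 (k - 1) r (k - 1 - 1) (by lia) (by lia)
      (fun s t _ _ => cadj_refl_low (by lia) (by lia) (by lia) s t) hr' (Or.inr rfl)
    refine ⟨σ, hσ' r rfl, ?_⟩
    rw [hσ q (by lia), hq']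
  rcases sep (m := k - 1) (p := k) (by lia) (by lia) (by lia) le_rfl (by lia) (by lia) (by lia)
    (closed_transfer hK h2 ψ (allClosed_cen (by lia))) with h | h
  · obtain ⟨σ, hσ⟩ := key r q h.1 h.2 hK
    exact ⟨σ, Or.inl hσ⟩
  · obtain ⟨σ, hσ⟩ := key q r h.1 h.2 (by rw [kadj_comm]; exact hK)
    exact ⟨σ, Or.inr hσ.symm⟩

lemma good_P {k : ℕ} (hk : 5 < k) : Good (DG k (k - 1) 0) := by
  apply good_of (c := k - 1) (d := k + 0) (c' := k - 1 - 1) (d' := k - 1) (by lia) (by lia) (by lia)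
    (by lia) (by lia) (by unfold dadj pr; lia) (by unfold dadj pr; lia) (by unfold pr; lia)
  intro r q f g K hK h1 h2 ψ
  have key : ∀ r q : Fin (2 * k), (r : ℕ) < k → k ≤ (q : ℕ) →
      (∀ a b : Fin (2 * k), K.Adj a b ↔ kadj k (k - 1) 0 (k - 1) (k + 0) r q f g a b) →
      ∃ σ : (DG k (k - 1) 0).deleteEdges {s(⟨k - 1, by lia⟩, ⟨k + 0, by lia⟩)} ≃g
        (DG k (k - 1) 0).deleteEdges {s(⟨k - 1, by lia⟩, ⟨k + 0, by lia⟩)},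
          (σ r : ℕ) = k - 1 ∧ (σ q : ℕ) = k + 0 := by
    intro r q hr hq hK
    obtain ⟨hr', hq'⟩ := caseP hk hr hq q.2 (noDeg3_transfer hK h2 ψ (noDeg3_cut hk))
      (closed_transfer hK h2 ψ (allClosed_cut (by lia) (by lia) (by lia) (by lia)))
    obtain ⟨σ, hσ, hσ'⟩ := aut_end h1 0 k r (k - 1) (by lia) (by lia)
      (fun s t _ _ => cadj_refl_left (by lia) s t) hr' (Or.inr rfl)
    obtain ⟨τ, hτ, hτ'⟩ := aut_end h1 k (2 * k) q (k + 0) (by lia) (by lia)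
      (fun s t hs ht => cadj_refl_right (by lia) (by lia) s t hs ht) hq' (Or.inl rfl)
    refine ⟨σ.trans τ, ?_, ?_⟩
    · change (τ (σ r) : ℕ) = _
      rw [hτ _ (by rw [hσ' r rfl]; lia), hσ' r rfl]
    · change (τ (σ q) : ℕ) = _
      rw [hσ q (by lia), hτ' q rfl]
  rcases sep (m := k) (p := k - 1) (by lia) (by lia) (by lia) (by lia) (by lia) (by lia) (by lia)
    (closed_transfer hK h2 ψ (allClosed_cut (by lia) (by lia) (by lia) (by lia))) with h | h
  · obtain ⟨σ, hσ⟩ := key r q h.1 h.2 hK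
    exact ⟨σ, Or.inl hσ⟩
  · obtain ⟨σ, hσ⟩ := key q r h.1 h.2 (by rw [kadj_comm]; exact hK)
    exact ⟨σ, Or.inr hσ.symm⟩

lemma good_A {k x : ℕ} (hx : 3 ≤ x) (hk : k = 2 * x + 1) : Good (DG k x x) := by
  apply good_of (c := x - 1 - 1) (d := x - 1) (c' := x - 1) (d' := x) (by lia) (by lia) (by lia)
    (by lia) (by lia) (by unfold dadj pr; lia) (by unfold dadj pr; lia) (by unfold pr; lia)
  intro r q f g K hK h1 h2 ψ
  have key : ∀ r q : Fin (2 * k), (r : ℕ) < x - 1 → x - 1 ≤ (q : ℕ) →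
      (∀ a b : Fin (2 * k), K.Adj a b ↔ kadj k x x (x - 1 - 1) (x - 1) r q f g a b) →
      ∃ σ : (DG k x x).deleteEdges {s(⟨x - 1 - 1, by lia⟩, ⟨x - 1, by lia⟩)} ≃g
        (DG k x x).deleteEdges {s(⟨x - 1 - 1, by lia⟩, ⟨x - 1, by lia⟩)},
          (σ r : ℕ) = x - 1 - 1 ∧ (σ q : ℕ) = x - 1 := by
    intro r q hr hq hK
    obtain ⟨hr', hq'⟩ := caseA hx hk hr hq q.2 (leafFar_transfer hK h2 ψ (leafFar_cut hx hk))
      (uniqDeg3_transfer hK h2 ψ (uniqDeg3_cut hx hk))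
      (closed_transfer hK h2 ψ (allClosed_cut (by lia) (by lia) (by lia) (by lia)))
    obtain ⟨σ, hσ, hσ'⟩ := aut_end h1 0 (x - 1) r (x - 1 - 1) (by lia) (by lia)
      (fun s t _ _ => cadj_refl_low (by lia) (by lia) (by lia) s t) hr' (Or.inr rfl)
    refine ⟨σ, hσ' r rfl, ?_⟩
    rw [hσ q (by lia), hq']
  rcases sep (m := x - 1) (p := x) (by lia) (by lia) (by lia) (by lia) (by lia) (by lia) (by lia)
    (closed_transfer hK h2 ψ (allClosed_cut (by lia) (by lia) (by lia) (by lia))) with h | h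
  · obtain ⟨σ, hσ⟩ := key r q h.1 h.2 hK
    exact ⟨σ, Or.inl hσ⟩
  · obtain ⟨σ, hσ⟩ := key q r h.1 h.2 (by rw [kadj_comm]; exact hK)
    exact ⟨σ, Or.inr hσ.symm⟩

lemma good_reflL {k i j : ℕ} (hi : i < k) (hj : j < k) (h : Good (DG k (k - 1 - i) j)) :
    Good (DG k i j) := by
  obtain ⟨σ, _⟩ := mkIso (DG_adj (k := k) (i := k - 1 - i) (j := j) (by lia))
    (DG_adj (k := k) (i := i) (j := j) hi) (reflIv 0 k)
    (by intro t ht; unfold reflIv; split_ifs <;> lia)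
    (by intro t ht; unfold reflIv; split_ifs <;> lia)
    (by intro s t hs ht h; unfold dadj pr at *; unfold reflIv; split_ifs <;> lia)
    (by intro s t hs ht h; unfold dadj pr at *; unfold reflIv; split_ifs <;> lia)
  exact Good.congr σ h

lemma good_swap {k i j : ℕ} (hi : i < k) (hj : j < k) (h : Good (DG k j i)) :
    Good (DG k i j) := by
  obtain ⟨σ, _⟩ := mkIso (DG_adj (k := k) (i := j) (j := i) (by lia))
    (DG_adj (k := k) (i := i) (j := j) hi) (fun t => if t < k then t + k else t - k)
    (by intro t ht; split_ifs <;> lia)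
    (by intro t ht; split_ifs <;> lia)
    (by intro s t hs ht h; unfold dadj pr at *; split_ifs <;> lia)
    (by intro s t hs ht h; unfold dadj pr at *; split_ifs <;> lia)
  exact Good.congr σ h

lemma good_reflR {k i j : ℕ} (hi : i < k) (hj : j < k) (h : Good (DG k i (k - 1 - j))) :
    Good (DG k i j) :=
  good_swap hi hj (good_reflL hj hi (good_swap (by lia) hi h))

lemma good_B' {k i j : ℕ} (hk : 5 < k) (hi : i + 1 < k) (hi0 : 0 < i) (hm : 2 * i + 1 ≠ k)
    (hj : j < k) : Good (DG k i j) := by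
  by_cases h : k < 2 * i + 1
  · exact good_B (m := 2 * i - (k - 1)) hk (by lia) hi hj (by lia)
  · exact good_reflL (by lia) hj
      (good_B (m := 2 * (k - 1 - i) - (k - 1)) hk (by lia) (by lia) hj (by lia))

lemma good_end {k j : ℕ} (hk : 5 < k) (hj : j < k) (hj' : j = 0 ∨ j = k - 1 ∨ 2 * j + 1 = k) :
    Good (DG k (k - 1) j) := by
  rcases hj' with rfl | rfl | h
  · exact good_P hk
  · apply good_reflR (by lia) (by lia)
    rw [Nat.sub_self]
    exact good_P hk
  · exact good_I hk h

lemma good_end' {k i j : ℕ} (hk : 5 < k) (hi : i = 0 ∨ i = k - 1) (hj : j < k)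
    (hj' : j = 0 ∨ j = k - 1 ∨ 2 * j + 1 = k) :
    Good (DG k i j) := by
  rcases hi with rfl | rfl
  · exact good_reflL (by lia) hj (good_end hk hj hj')
  · exact good_end hk hj hj'

lemma good_all {k i j : ℕ} (hk : 5 < k) (hi : i < k) (hj : j < k) : Good (DG k i j) := by
  by_cases h1 : i = 0 ∨ i = k - 1 ∨ 2 * i + 1 = k
  · by_cases h2 : j = 0 ∨ j = k - 1 ∨ 2 * j + 1 = k
    · by_cases h3 : i = 0 ∨ i = k - 1
      · exact good_end' hk h3 hj h2
      · by_cases h4 : j = 0 ∨ j = k - 1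
        · exact good_swap hi hj (good_end' hk h4 hi h1)
        · obtain rfl : i = j := by lia
          exact good_A (by lia) (by lia)
    · exact good_swap hi hj (good_B' hk (by lia) (by lia) (by lia) hi)
  · exact good_B' hk (by lia) (by lia) (by lia) hj

lemma iso_DG {V : Type} {k : ℕ} (T : SimpleGraph V) (A : Set V) (a b : V) (ha : a ∈ A) (hb : b ∈ Aᶜ)
    (φ : T.induce A ≃g pathGraph k) (ψ : T.induce Aᶜ ≃g pathGraph k)
    (hc : ∀ u v, u ∈ A → v ∈ Aᶜ → (T.Adj u v ↔ u = a ∧ v = b)) :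
    ∃ i j, i < k ∧ j < k ∧ Nonempty (T ≃g DG k i j) := by
  classical
  refine ⟨φ ⟨a, ha⟩, ψ ⟨b, hb⟩, Fin.is_lt _, Fin.is_lt _, ?_⟩
  let F : V → Fin (2 * k) := fun v =>
    if h : v ∈ A then ⟨φ ⟨v, h⟩, by have := (φ ⟨v, h⟩).2; lia⟩
    else ⟨k + ψ ⟨v, h⟩, by have := (ψ ⟨v, h⟩).2; lia⟩
  have hF1 : ∀ v (h : v ∈ A), (F v : ℕ) = φ ⟨v, h⟩ := by
    intro v h
    simp only [F, dif_pos h]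
  have hF2 : ∀ v (h : v ∈ Aᶜ), (F v : ℕ) = k + ψ ⟨v, h⟩ := by
    intro v h
    have h' : v ∉ A := h
    simp only [F, dif_neg h']
  have hφ : ∀ u v (hu : u ∈ A) (hv : v ∈ A), ((φ ⟨u, hu⟩ : Fin k) : ℕ) = φ ⟨v, hv⟩ → u = v := by
    intro u v hu hv h
    have := φ.injective (Fin.ext h)
    exact congrArg Subtype.val this
  have hψ : ∀ u v (hu : u ∈ Aᶜ) (hv : v ∈ Aᶜ), ((ψ ⟨u, hu⟩ : Fin k) : ℕ) = ψ ⟨v, hv⟩ → u = v := by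
    intro u v hu hv h
    have := ψ.injective (Fin.ext h)
    exact congrArg Subtype.val this
  have hinj : Function.Injective F := by
    intro u v h
    have h' : (F u : ℕ) = F v := congrArg _ h
    by_cases hu : u ∈ A <;> by_cases hv : v ∈ A
    · rw [hF1 _ hu, hF1 _ hv] at h'
      exact hφ _ _ _ _ h'
    · rw [hF1 _ hu, hF2 _ hv] at h'
      have := (φ ⟨u, hu⟩).2
      lia
    · rw [hF2 _ hu, hF1 _ hv] at h'
      have := (φ ⟨v, hv⟩).2
      lia
    · rw [hF2 _ hu, hF2 _ hv] at h'
      exact hψ _ _ hu hv (by lia)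
  have hsurj : Function.Surjective F := by
    intro t
    by_cases ht : (t : ℕ) < k
    · obtain ⟨⟨v, hv⟩, h⟩ := φ.surjective ⟨t, ht⟩
      refine ⟨v, Fin.ext ?_⟩
      rw [hF1 _ hv, h]
    · obtain ⟨⟨v, hv⟩, h⟩ := ψ.surjective ⟨t - k, by lia⟩
      refine ⟨v, Fin.ext ?_⟩
      rw [hF2 _ hv, h]
      simp only
      lia
  have hcross : ∀ u v (hu : u ∈ A) (hv : v ∈ Aᶜ),
      (dadj k (φ ⟨a, ha⟩ : Fin k) (ψ ⟨b, hb⟩ : Fin k) (F u) (F v) ↔ u = a ∧ v = b) := by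
    intro u v hu hv
    have l1 := (φ ⟨u, hu⟩).2
    have l2 := (ψ ⟨v, hv⟩).2
    have l3 := (φ ⟨a, ha⟩).2
    have l4 := (ψ ⟨b, hb⟩).2
    rw [hF1 _ hu, hF2 _ hv]
    constructor
    · intro h
      unfold dadj pr at h
      exact ⟨hφ _ _ hu ha (by lia), hψ _ _ hv hb (by lia)⟩
    · rintro ⟨rfl, rfl⟩
      exact Or.inr (Or.inr (Or.inl ⟨rfl, rfl⟩))
  have hds : ∀ u v : ℕ, dadj k (φ ⟨a, ha⟩ : Fin k) (ψ ⟨b, hb⟩ : Fin k) u v ↔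
      dadj k (φ ⟨a, ha⟩ : Fin k) (ψ ⟨b, hb⟩ : Fin k) v u := by
    intro u v
    unfold dadj pr
    lia
  refine ⟨⟨Equiv.ofBijective F ⟨hinj, hsurj⟩, ?_⟩⟩
  intro u v
  rw [DG_adj (Fin.is_lt _)]
  change dadj k (φ ⟨a, ha⟩ : Fin k) (ψ ⟨b, hb⟩ : Fin k) (F u) (F v) ↔ T.Adj u v
  by_cases hu : u ∈ A <;> by_cases hv : v ∈ A
  · have h1 : (T.induce A).Adj ⟨u, hu⟩ ⟨v, hv⟩ ↔ T.Adj u v := Iff.rfl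
    rw [← h1, ← φ.map_adj_iff, pathGraph_adj, hF1 _ hu, hF1 _ hv]
    have l1 := (φ ⟨u, hu⟩).2
    have l2 := (φ ⟨v, hv⟩).2
    unfold dadj pr
    lia
  · rw [hcross u v hu hv, hc u v hu hv]
  · rw [hds, hcross v u hv hu, T.adj_comm, hc v u hv hu]
  · have h1 : (T.induce Aᶜ).Adj ⟨u, hu⟩ ⟨v, hv⟩ ↔ T.Adj u v := Iff.rfl
    rw [← h1, ← ψ.map_adj_iff, pathGraph_adj, hF2 _ hu, hF2 _ hv]
    have l1 := (ψ ⟨u, hu⟩).2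
    have l2 := (ψ ⟨v, hv⟩).2
    have l3 := (φ ⟨a, ha⟩).2
    unfold dadj pr
    lia

lemma tree_iso_DG {V : Type} (T : SimpleGraph V) (hT : T.IsTree)
    (a b : V) (hab : T.Adj a b) (k : ℕ)
    (hGa : Nonempty
      ((T.deleteEdges {s(a, b)}).induce
        ((T.deleteEdges {s(a, b)}).connectedComponentMk a).supp ≃g pathGraph k))
    (hHb : Nonempty
      ((T.deleteEdges {s(a, b)}).induce
        ((T.deleteEdges {s(a, b)}).connectedComponentMk b).supp ≃g pathGraph k)) :
    ∃ i j, i < k ∧ j < k ∧ Nonempty (T ≃g DG k i j) := by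
  have hbr : ¬ (T.deleteEdges {s(a, b)}).Reachable a b := by
    have h := isAcyclic_iff_forall_adj_isBridge.1 hT.isAcyclic hab
    rw [isBridge_iff] at h
    simpa using h
  set G := T.deleteEdges {s(a, b)} with hG
  have hGadj : ∀ u v, G.Adj u v ↔ T.Adj u v ∧ ¬ s(u, v) = s(a, b) := by
    intro u v
    rw [hG, deleteEdges_adj, Set.mem_singleton_iff]
  have hma : ∀ v, v ∈ (G.connectedComponentMk a).supp ↔ G.Reachable v a := by
    intro v
    rw [ConnectedComponent.mem_supp_iff, ConnectedComponent.eq]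
  have hmb : ∀ v, v ∈ (G.connectedComponentMk b).supp ↔ G.Reachable v b := by
    intro v
    rw [ConnectedComponent.mem_supp_iff, ConnectedComponent.eq]
  have hall : ∀ v, G.Reachable v a ∨ G.Reachable v b := by
    have key : ∀ u v, T.Walk u v → (G.Reachable v a ∨ G.Reachable v b) →
        (G.Reachable u a ∨ G.Reachable u b) := by
      intro u v w
      induction w with
      | nil => exact id
      | @cons x y z h p ih =>
        intro h1
        by_cases h' : s(x, y) = s(a, b)
        · rw [Sym2.eq_iff] at h'
          rcases h' with ⟨rfl, rfl⟩ | ⟨rfl, rfl⟩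
          · exact Or.inl (Reachable.refl _)
          · exact Or.inr (Reachable.refl _)
        · have h2 : G.Adj x y := (hGadj x y).2 ⟨h, h'⟩
          exact (ih h1).imp (h2.reachable.trans ·) (h2.reachable.trans ·)
    intro v
    obtain ⟨w⟩ := hT.connected.preconnected v a
    exact key v a w (Or.inl (Reachable.refl _))
  have hset : (G.connectedComponentMk b).supp = ((G.connectedComponentMk a).supp)ᶜ := by
    ext v
    rw [Set.mem_compl_iff, hma, hmb]
    constructor
    · intro h1 h2
      exact hbr (h2.symm.trans h1)
    · intro h
      exact (hall v).resolve_left h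
  rw [hset] at hHb
  obtain ⟨φ⟩ := hGa
  obtain ⟨ψ⟩ := hHb
  have haA : a ∈ (G.connectedComponentMk a).supp := (hma a).2 (Reachable.refl _)
  have hbA : b ∈ ((G.connectedComponentMk a).supp)ᶜ := by
    rw [Set.mem_compl_iff, hma]
    exact fun h => hbr h.symm
  have e1 : T.induce (G.connectedComponentMk a).supp = G.induce (G.connectedComponentMk a).supp := by
    ext ⟨u, hu⟩ ⟨v, hv⟩
    simp only [comap_adj, Function.Embedding.subtype_apply]
    rw [hGadj]
    refine ⟨fun h => ⟨h, fun h' => ?_⟩, fun h => h.1⟩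
    rw [Sym2.eq_iff] at h'
    rcases h' with ⟨rfl, rfl⟩ | ⟨rfl, rfl⟩
    · exact hbA hv
    · exact hbA hu
  have e2 : T.induce ((G.connectedComponentMk a).supp)ᶜ
      = G.induce ((G.connectedComponentMk a).supp)ᶜ := by
    ext ⟨u, hu⟩ ⟨v, hv⟩
    simp only [comap_adj, Function.Embedding.subtype_apply]
    rw [hGadj]
    refine ⟨fun h => ⟨h, fun h' => ?_⟩, fun h => h.1⟩
    rw [Sym2.eq_iff] at h'
    rcases h' with ⟨rfl, rfl⟩ | ⟨rfl, rfl⟩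
    · exact hu haA
    · exact hv haA
  rw [← e1] at φ
  rw [← e2] at ψ
  apply iso_DG T _ a b haA hbA φ ψ
  intro u v hu hv
  constructor
  · intro h
    by_cases h' : s(u, v) = s(a, b)
    · rw [Sym2.eq_iff] at h'
      rcases h' with h' | ⟨rfl, rfl⟩
      · exact h'
      · exact absurd hu hbA
    · exfalso
      have h2 : G.Adj u v := (hGadj u v).2 ⟨h, h'⟩
      apply hv
      rw [hma] at hu ⊢
      exact h2.reachable.symm.trans hu
  · rintro ⟨rfl, rfl⟩
    exact hab

lemma no_one {V : Type} [Fintype V] (T : SimpleGraph V) (htri : ∀ x y z, T.Adj x y → T.Adj y z → T.Adj x z → False)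
    (e : Sym2 V) (x y z : V) (hxy : T.Adj x y) (hyz : T.Adj y z) (hxz : x ≠ z)
    (h1 : s(x, y) ≠ e) (h2 : s(y, z) ≠ e) :
    ∃ (H : SimpleGraph V) (f : Sym2 V), f ∈ H.edgeSet ∧
      Nonempty (H.deleteEdges {f} ≃g T.deleteEdges {e}) ∧ ¬ Nonempty (H ≃g T) := by
  let H : SimpleGraph V := T.deleteEdges {e} ⊔ fromEdgeSet {s(x, z)}
  have hH : ∀ u v, H.Adj u v ↔ (T.Adj u v ∧ s(u, v) ≠ e) ∨ (s(u, v) = s(x, z) ∧ u ≠ v) := by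
    intro u v
    simp only [H, sup_adj, deleteEdges_adj, fromEdgeSet_adj, Set.mem_singleton_iff, ne_eq]
  refine ⟨H, s(x, z), (hH _ _).2 (Or.inr ⟨rfl, hxz⟩), ?_, ?_⟩
  · have : H.deleteEdges {s(x, z)} = T.deleteEdges {e} := by
      ext u v
      rw [deleteEdges_adj, hH, deleteEdges_adj, Set.mem_singleton_iff, Set.mem_singleton_iff]
      constructor
      · rintro ⟨h | h, h'⟩
        · exact h
        · exact absurd h.1 h'
      · rintro ⟨h, h'⟩
        refine ⟨Or.inl ⟨h, h'⟩, ?_⟩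
        intro h''
        have : T.Adj x z := by
          rw [← mem_edgeSet, ← h'']
          exact h
        exact htri _ _ _ hxy hyz this
    rw [this]
    exact ⟨SimpleGraph.Iso.refl⟩
  · rintro ⟨φ⟩
    exact htri (φ x) (φ y) (φ z) (φ.map_adj_iff.2 ((hH _ _).2 (Or.inl ⟨hxy, h1⟩)))
      (φ.map_adj_iff.2 ((hH _ _).2 (Or.inl ⟨hyz, h2⟩)))
      (φ.map_adj_iff.2 ((hH _ _).2 (Or.inr ⟨rfl, hxz⟩)))

lemma ern_eq_two {V : Type} [Fintype V] (T : SimpleGraph V) {k i j : ℕ} (hk : 5 < k) (hi : i < k)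
    (hj : j < k) (ι : T ≃g DG k i j) : ern T = 2 := by
  classical
  have hgood : Good T := Good.congr ι.symm (good_all hk hi hj)
  unfold ern
  refine le_antisymm (Nat.sInf_le (ern_le_of_good hgood)) ?_
  refine le_csInf ⟨2, ern_le_of_good hgood⟩ ?_
  rintro m ⟨s, hs, hsT, h⟩
  by_contra hlt
  have hm : m = 0 ∨ m = 1 := by lia
  rcases hm with rfl | rfl
  · rw [Finset.card_eq_zero] at hs
    subst hs
    obtain ⟨φ⟩ := h (Fin 0) inferInstance ⊥ ∅ (by simp) ⟨
      ⟨fun x => (Finset.notMem_empty _ x.2).elim, fun x => (Finset.notMem_empty _ x.2).elim, fun x => (Finset.notMem_empty _ x.2).elim,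
        fun x => (Finset.notMem_empty _ x.2).elim⟩, fun x => (Finset.notMem_empty _ x.2).elim⟩
    exact (φ.symm (ι.symm ⟨0, by lia⟩)).elim0
  · rw [Finset.card_eq_one] at hs
    obtain ⟨e, rfl⟩ := hs
    have htri : ∀ x y z, T.Adj x y → T.Adj y z → T.Adj x z → False := by
      intro x y z h1 h2 h3
      rw [← ι.map_adj_iff, DG_adj hi] at h1 h2 h3
      have l1 := (ι x).2
      have l2 := (ι y).2
      have l3 := (ι z).2
      unfold dadj pr at h1 h2 h3
      lia
    have hadj : ∀ u (hu : u + 1 < k), T.Adj (ι.symm ⟨u, by lia⟩) (ι.symm ⟨u + 1, by lia⟩) := by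
      intro u hu
      rw [ι.symm.map_adj_iff, DG_adj hi]
      exact Or.inl ⟨rfl, by simp only; lia⟩
    have hne : ∀ u v (hu : u < 2 * k) (hv : v < 2 * k), u ≠ v → ι.symm ⟨u, hu⟩ ≠ ι.symm ⟨v, hv⟩ := by
      intro u v hu hv huv h
      have := ι.symm.injective h
      rw [Fin.mk.injEq] at this
      exact huv this
    have hex : ∃ (H : SimpleGraph V) (f : Sym2 V), f ∈ H.edgeSet ∧
      Nonempty (H.deleteEdges {f} ≃g T.deleteEdges {e}) ∧ ¬ Nonempty (H ≃g T) := by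
      by_cases he : s(ι.symm ⟨0, by lia⟩, ι.symm ⟨1, by lia⟩) ≠ e ∧
          s(ι.symm ⟨1, by lia⟩, ι.symm ⟨2, by lia⟩) ≠ e
      · exact no_one T htri e _ _ _ (hadj 0 (by lia)) (hadj 1 (by lia))
          (hne 0 2 (by lia) (by lia) (by lia)) he.1 he.2
      · have hd : ∀ a b c d (ha : a < 2 * k) (hb : b < 2 * k) (hc : c < 2 * k) (hd : d < 2 * k),
            s(ι.symm ⟨a, ha⟩, ι.symm ⟨b, hb⟩) = e → a ≠ c → a ≠ d →
            s(ι.symm ⟨c, hc⟩, ι.symm ⟨d, hd⟩) ≠ e := by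
          rintro a b c d ha hb hc hd rfl h1 h2 h3
          rw [Sym2.eq_iff] at h3
          rcases h3 with h3 | h3
          · exact hne _ _ _ _ h1 h3.1.symm
          · exact hne _ _ _ _ h2 h3.2.symm
        have he' : s(ι.symm ⟨0, by lia⟩, ι.symm ⟨1, by lia⟩) = e ∨
          s(ι.symm ⟨1, by lia⟩, ι.symm ⟨2, by lia⟩) = e := by tauto
        refine no_one T htri e _ _ _ (hadj 3 (by lia)) (hadj 4 (by lia))
          (hne 3 5 (by lia) (by lia) (by lia)) ?_ ?_
        · rcases he' with he' | he'
          · exact hd _ _ _ _ _ _ _ _ he' (by lia) (by lia)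
          · exact hd _ _ _ _ _ _ _ _ he' (by lia) (by lia)
        · rcases he' with he' | he'
          · exact hd _ _ _ _ _ _ _ _ he' (by lia) (by lia)
          · exact hd _ _ _ _ _ _ _ _ he' (by lia) (by lia)
    obtain ⟨H, f, hf, ⟨ψ⟩, hn⟩ := hex
    apply hn
    refine h V inferInstance H {f} (by simpa using hf) ⟨?_, ?_⟩
    · exact ⟨fun _ => ⟨f, by simp⟩, fun _ => ⟨e, by simp⟩,
        fun x => Subtype.ext (Finset.mem_singleton.1 x.2).symm,
        fun x => Subtype.ext (Finset.mem_singleton.1 x.2).symm⟩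
    · rintro ⟨x, hx⟩
      obtain rfl := Finset.mem_singleton.1 hx
      exact ⟨ψ⟩

/-- If `T` is a bicentroidal tree both of whose centroidal components are isomorphic to the
path `P_k`, with `k > 5`, then `ern(T) = 2`. -/
theorem stmt13 {V : Type} [Fintype V] (T : SimpleGraph V) (hT : T.IsTree)
    (a b : V) (hab : T.Adj a b) (hcent : centroid T = {a, b}) (k : ℕ) (hk : 5 < k)
    (hGa : Nonempty
      ((T.deleteEdges {s(a, b)}).induce
        ((T.deleteEdges {s(a, b)}).connectedComponentMk a).supp ≃g pathGraph k))
    (hHb : Nonempty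
      ((T.deleteEdges {s(a, b)}).induce
        ((T.deleteEdges {s(a, b)}).connectedComponentMk b).supp ≃g pathGraph k)) :
    ern T = 2 := by
  obtain ⟨i, j, hi, hj, ⟨ι⟩⟩ := tree_iso_DG T hT a b hab k hGa hHb
  exact ern_eq_two T hk hi hj ι

end ErnPaper
end
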